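/- For all real numbers γ* > 0 and d_* > 0 there exists a constant C_λ > 0 such that for every convex polygon Ω of diameter 1 satisfying G1 (γ < γ*) and G2 (|v_i − v_j| > d_* for all i ≠ j) and every index i, the mean value coordinate λ_i satisfies the H¹-norm bound ∫_Ω (λ_i(x)² + ‖∇λ_i(x)‖²) dx ≤ C_λ². -/

import Mathlib

open EuclideanGeometry Metric Real

noncomputable section

abbrev E2 := EuclideanSpace ℝ (Fin 2)

structure ConvexPolygon (n : ℕ) [NeZero n] where
  v : Fin n → E2
  hn : 3 ≤ n
  extreme : ∀ i, v i ∈ Set.extremePoints ℝ (convexHull ℝ (Set.range v))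
  boundary : frontier (convexHull ℝ (Set.range v)) = ⋃ i, segment ℝ (v i) (v (i + 1))

namespace ConvexPolygon

variable {n : ℕ} [NeZero n] (P : ConvexPolygon n)

def region : Set E2 := convexHull ℝ (Set.range P.v)

def edge (i : Fin n) : Set E2 := segment ℝ (P.v i) (P.v (i + 1))

def inradius : ℝ := sSup {r : ℝ | ∃ c : E2, Metric.closedBall c r ⊆ P.region}

def G1 (γs : ℝ) : Prop := Metric.diam P.region / P.inradius < γs

def G2 (ds : ℝ) : Prop := ∀ i j : Fin n, i ≠ j → ds < dist (P.v i) (P.v j)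

def interiorAngle (i : Fin n) : ℝ := ∠ (P.v (i - 1)) (P.v i) (P.v (i + 1))

def angleAt (i : Fin n) (x : E2) : ℝ := ∠ (P.v i) x (P.v (i + 1))

def r (i : Fin n) (x : E2) : ℝ := dist x (P.v i)

def t (i : Fin n) (x : E2) : ℝ := Real.tan (P.angleAt i x / 2)

def w (i : Fin n) (x : E2) : ℝ := (P.t (i - 1) x + P.t i x) / P.r i x

def lambda (i : Fin n) (x : E2) : ℝ := P.w i x / ∑ j, P.w j x

def nonadjacent (i j : Fin n) : Prop := i ≠ j ∧ i ≠ j + 1 ∧ j ≠ i + 1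

def SepProp (h : ℝ) : Prop :=
  ∀ x ∈ P.region,
    (∀ i j k : Fin n, i ≠ j → j ≠ k → i ≠ k →
      ¬((Metric.closedBall x h ∩ P.edge i).Nonempty ∧
        (Metric.closedBall x h ∩ P.edge j).Nonempty ∧
        (Metric.closedBall x h ∩ P.edge k).Nonempty)) ∧
    (∀ i j : Fin n, nonadjacent i j →
      ¬((Metric.closedBall x h ∩ P.edge i).Nonempty ∧
        (Metric.closedBall x h ∩ P.edge j).Nonempty))

end ConvexPolygon


/-- signed planar cross product -/
def XX (σ : ℝ) (u v : E2) : ℝ := σ * (u 0 * v 1 - u 1 * v 0)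

lemma norm_sq_E2 (u : E2) : ‖u‖ ^ 2 = u 0 ^ 2 + u 1 ^ 2 := by
  rw [EuclideanSpace.real_norm_sq_eq]; simp [Fin.sum_univ_two]

lemma inner_E2 (u v : E2) : inner ℝ u v = u 0 * v 0 + u 1 * v 1 := by
  simp [PiLp.inner_apply, Fin.sum_univ_two]; ring

lemma abs_XX_le {σ : ℝ} (hσ : σ ^ 2 = 1) (u v : E2) : |XX σ u v| ≤ ‖u‖ * ‖v‖ := by
  apply abs_le_of_sq_le_sq _ (by positivity)
  rw [mul_pow, norm_sq_E2, norm_sq_E2, XX, mul_pow, hσ]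
  nlinarith [sq_nonneg (u 0 * v 0 + u 1 * v 1)]

lemma XX_add_left (σ : ℝ) (u v w : E2) : XX σ (u + v) w = XX σ u w + XX σ v w := by
  simp [XX]; ring
lemma XX_add_right (σ : ℝ) (u v w : E2) : XX σ w (u + v) = XX σ w u + XX σ w v := by
  simp [XX]; ring
lemma XX_sub_left (σ : ℝ) (u v w : E2) : XX σ (u - v) w = XX σ u w - XX σ v w := by
  simp [XX]; ring
lemma XX_sub_right (σ : ℝ) (u v w : E2) : XX σ w (u - v) = XX σ w u - XX σ w v := by
  simp [XX]; ring
lemma XX_smul_left (σ s : ℝ) (u v : E2) : XX σ (s • u) v = s * XX σ u v := by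
  simp [XX]; ring
lemma XX_smul_right (σ s : ℝ) (u v : E2) : XX σ u (s • v) = s * XX σ u v := by
  simp [XX]; ring
lemma XX_self (σ : ℝ) (u : E2) : XX σ u u = 0 := by
  simp [XX]; ring_nf; simp
lemma XX_swap (σ : ℝ) (u v : E2) : XX σ u v = - XX σ v u := by
  simp [XX]; ring

lemma XX_sq_add {σ : ℝ} (hσ : σ ^ 2 = 1) (u v : E2) :
    XX σ u v ^ 2 + inner ℝ u v ^ 2 = ‖u‖ ^ 2 * ‖v‖ ^ 2 := by
  rw [norm_sq_E2, norm_sq_E2, inner_E2, XX, mul_pow, hσ]; ring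

/-- three-vector identity in norm form -/
lemma norm_mul_XX_le (σ : ℝ) (g C v : E2) :
    ‖v‖ * XX σ g C ≤ ‖g‖ * |XX σ v C| + ‖C‖ * |XX σ g v| := by
  have h : (XX σ g C) • v = (XX σ v C) • g + (XX σ g v) • C := by
    ext i
    fin_cases i <;> simp [XX] <;> ring
  calc ‖v‖ * XX σ g C ≤ ‖v‖ * |XX σ g C| := by gcongr; exact le_abs_self _
    _ = ‖(XX σ g C) • v‖ := by rw [norm_smul, Real.norm_eq_abs]; ring
    _ ≤ ‖(XX σ v C) • g‖ + ‖(XX σ g v) • C‖ := by rw [h]; exact norm_add_le _ _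
    _ = _ := by rw [norm_smul, norm_smul, Real.norm_eq_abs, Real.norm_eq_abs]; ring

lemma wedge {σ : ℝ} (hσ : σ ^ 2 = 1) {ρ s s' : ℝ} {A B C g : E2} (hC : ‖C‖ ≤ 1)
    (hA : ρ * ‖A‖ ≤ XX σ A C) (hB : ρ * ‖B‖ ≤ XX σ C B) (hs : 0 ≤ s) (hs' : 0 ≤ s')
    (h1 : ‖A - s • g‖ < ρ * ‖A‖) (h2 : ‖B - s' • g‖ < ρ * ‖B‖) : False := by
  have e1 := abs_le.1 (abs_XX_le hσ (A - s • g) C)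
  have e2 := abs_le.1 (abs_XX_le hσ C (B - s' • g))
  have b1 : ‖A - s • g‖ * ‖C‖ ≤ ‖A - s • g‖ := mul_le_of_le_one_right (norm_nonneg _) hC
  have b2 : ‖C‖ * ‖B - s' • g‖ ≤ ‖B - s' • g‖ := mul_le_of_le_one_left (norm_nonneg _) hC
  rw [XX_sub_left, XX_smul_left] at e1
  rw [XX_sub_right, XX_smul_right, XX_swap σ C g] at e2
  have p1 : 0 < s * XX σ g C := by linarith
  have p2 : 0 < s' * -XX σ g C := by linarith
  have q1 := pos_of_mul_pos_right p1 hs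
  have q2 := pos_of_mul_pos_right p2 hs'
  linarith

section TanHalf


/-- unit vector -/
lemma tan_half_nonneg (a b : E2) : 0 ≤ Real.tan (InnerProductGeometry.angle a b / 2) := by
  apply Real.tan_nonneg_of_nonneg_of_le_pi_div_two
  · have := InnerProductGeometry.angle_nonneg a b; linarith
  · have := InnerProductGeometry.angle_le_pi a b; linarith

lemma unit_add_sq {a b : E2} (ha : a ≠ 0) (hb : b ≠ 0) :
    ‖(‖a‖⁻¹ • a) + (‖b‖⁻¹ • b)‖ ^ 2 = (2 * Real.cos (InnerProductGeometry.angle a b / 2)) ^ 2 := by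
  have ha' : ‖a‖ ≠ 0 := norm_ne_zero_iff.2 ha
  have hb' : ‖b‖ ≠ 0 := norm_ne_zero_iff.2 hb
  have h : 2 * Real.cos (InnerProductGeometry.angle a b / 2) ^ 2 = 1 + Real.cos (InnerProductGeometry.angle a b) := by
    rw [Real.cos_sq]; ring_nf
  rw [norm_add_sq_real, norm_smul, norm_smul, real_inner_smul_left, real_inner_smul_right,
    mul_pow, mul_pow 2, pow_two 2, mul_assoc 2 2, h, InnerProductGeometry.cos_angle]
  simp
  field_simp
  ring

lemma unit_sub_sq {a b : E2} (ha : a ≠ 0) (hb : b ≠ 0) :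
    ‖(‖a‖⁻¹ • a) - (‖b‖⁻¹ • b)‖ ^ 2 = (2 * Real.sin (InnerProductGeometry.angle a b / 2)) ^ 2 := by
  have ha' : ‖a‖ ≠ 0 := norm_ne_zero_iff.2 ha
  have hb' : ‖b‖ ≠ 0 := norm_ne_zero_iff.2 hb
  have h : 2 * Real.sin (InnerProductGeometry.angle a b / 2) ^ 2 = 1 - Real.cos (InnerProductGeometry.angle a b) := by
    rw [Real.sin_sq, Real.cos_sq]; ring_nf
  rw [norm_sub_sq_real, norm_smul, norm_smul, real_inner_smul_left, real_inner_smul_right,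
    mul_pow 2, pow_two 2, mul_assoc 2 2, h, InnerProductGeometry.cos_angle]
  simp
  field_simp
  ring

lemma tan_mul_unit_add {a b : E2} (ha : a ≠ 0) (hb : b ≠ 0) :
    Real.tan (InnerProductGeometry.angle a b / 2) * ‖(‖a‖⁻¹ • a) + (‖b‖⁻¹ • b)‖ ≤ 2 := by
  have hc : 0 ≤ Real.cos (InnerProductGeometry.angle a b / 2) := by
    apply Real.cos_nonneg_of_neg_pi_div_two_le_of_le
    · have := InnerProductGeometry.angle_nonneg a b; have := Real.pi_pos; linarith
    · have := InnerProductGeometry.angle_le_pi a b; linarith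
  have h := unit_add_sq ha hb
  rw [sq_eq_sq₀ (norm_nonneg _) (by positivity)] at h
  rw [h]
  rcases eq_or_ne (Real.cos (InnerProductGeometry.angle a b / 2)) 0 with h0 | h0
  · rw [h0]; simp
  · rw [Real.tan_eq_sin_div_cos]
    field_simp
    have := Real.sin_le_one (InnerProductGeometry.angle a b / 2)
    linarith

lemma unit_sub_le_tan {σ : ℝ} {a b : E2} (hX : 0 < XX σ a b) :
    ‖(‖a‖⁻¹ • a) - (‖b‖⁻¹ • b)‖ ≤ 2 * Real.tan (InnerProductGeometry.angle a b / 2) := by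
  have ha : a ≠ 0 := by rintro rfl; simp [XX] at hX
  have hb : b ≠ 0 := by rintro rfl; simp [XX] at hX
  have hpi : InnerProductGeometry.angle a b ≠ π := by
    intro h
    obtain ⟨_, s, _, rfl⟩ := InnerProductGeometry.angle_eq_pi_iff.1 h
    rw [XX_smul_right, XX_self] at hX
    simp at hX
  have hc : 0 < Real.cos (InnerProductGeometry.angle a b / 2) := by
    apply Real.cos_pos_of_mem_Ioo
    constructor
    · have := InnerProductGeometry.angle_nonneg a b; have := Real.pi_pos; linarith
    · have := lt_of_le_of_ne (InnerProductGeometry.angle_le_pi a b) hpi; linarith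
  have hs : 0 ≤ Real.sin (InnerProductGeometry.angle a b / 2) := by
    apply Real.sin_nonneg_of_nonneg_of_le_pi
    · have := InnerProductGeometry.angle_nonneg a b; linarith
    · have := InnerProductGeometry.angle_le_pi a b; have := Real.pi_pos; linarith
  have h := unit_sub_sq ha hb
  rw [sq_eq_sq₀ (norm_nonneg _) (by positivity)] at h
  rw [h, Real.tan_eq_sin_div_cos]
  gcongr
  rw [le_div_iff₀ hc]
  exact mul_le_of_le_one_right hs (Real.cos_le_one _)

lemma den_pos {σ : ℝ} (hσ : σ ^ 2 = 1) {a b : E2} (hX : 0 < XX σ a b) :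
    0 < ‖a‖ * ‖b‖ + inner ℝ a b := by
  have h := XX_sq_add hσ a b
  have h2 : (inner ℝ a b) ^ 2 < (‖a‖ * ‖b‖) ^ 2 := by nlinarith [pow_pos hX 2]
  have := abs_lt_of_sq_lt_sq h2 (by positivity)
  linarith [(abs_lt.1 this).1]

lemma tan_half_eq {σ : ℝ} (hσ : σ ^ 2 = 1) {a b : E2} (hX : 0 < XX σ a b) :
    Real.tan (InnerProductGeometry.angle a b / 2) = XX σ a b / (‖a‖ * ‖b‖ + inner ℝ a b) := by
  have hD := den_pos hσ hX
  have ha : 0 < ‖a‖ := norm_pos_iff.2 (by rintro rfl; simp [XX] at hX)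
  have hb : 0 < ‖b‖ := norm_pos_iff.2 (by rintro rfl; simp [XX] at hX)
  have hsin : Real.sin (InnerProductGeometry.angle a b) * (‖a‖ * ‖b‖) = XX σ a b := by
    rw [InnerProductGeometry.sin_angle_mul_norm_mul_norm, Real.sqrt_eq_iff_mul_self_eq_of_pos hX]
    have := XX_sq_add hσ a b
    rw [real_inner_self_eq_norm_sq, real_inner_self_eq_norm_sq]
    linarith
  have hcos := InnerProductGeometry.cos_angle_mul_norm_mul_norm a b
  have hs2 : Real.sin (InnerProductGeometry.angle a b) = 2 * Real.sin (InnerProductGeometry.angle a b / 2) * Real.cos (InnerProductGeometry.angle a b / 2) := by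
    rw [← Real.sin_two_mul]; ring_nf
  have hc2 : Real.cos (InnerProductGeometry.angle a b) = 2 * Real.cos (InnerProductGeometry.angle a b / 2) ^ 2 - 1 := by
    rw [← Real.cos_two_mul]; ring_nf
  rw [hs2] at hsin
  rw [hc2] at hcos
  have hc : Real.cos (InnerProductGeometry.angle a b / 2) ≠ 0 := by
    intro h; rw [h] at hsin; simp at hsin; linarith
  rw [← hsin, ← hcos, Real.tan_eq_sin_div_cos]
  have : ‖a‖ * ‖b‖ + (2 * Real.cos (InnerProductGeometry.angle a b / 2) ^ 2 - 1) * (‖a‖ * ‖b‖)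
    = 2 * Real.cos (InnerProductGeometry.angle a b / 2) ^ 2 * (‖a‖ * ‖b‖) := by ring
  rw [this]
  field_simp

end TanHalf

lemma hasDerivAt_norm_line {a : E2} (ha : a ≠ 0) (u : E2) :
    HasDerivAt (fun s : ℝ => ‖a - s • u‖) (-(inner ℝ a u / ‖a‖)) 0 := by
  have h0 : HasDerivAt (fun s : ℝ => a - s • u) (-u) 0 := by
    simpa using ((hasDerivAt_id (0 : ℝ)).smul_const u).const_sub a
  have h1 := h0.norm_sq
  have hne : ‖a - (0 : ℝ) • u‖ ^ 2 ≠ 0 := by simpa using ha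
  have h2 := h1.sqrt hne
  have e : (fun s : ℝ => √(‖a - s • u‖ ^ 2)) = fun s : ℝ => ‖a - s • u‖ := by
    funext s; exact Real.sqrt_sq (norm_nonneg _)
  rw [e] at h2
  convert h2 using 1
  rw [Real.sqrt_sq (norm_nonneg _)]
  simp
  field_simp

lemma hasDerivAt_inner_line (a b u : E2) :
    HasDerivAt (fun s : ℝ => (inner ℝ (a - s • u) (b - s • u) : ℝ))
      (-(inner ℝ a u + inner ℝ b u)) 0 := by
  have h0 : ∀ c : E2, HasDerivAt (fun s : ℝ => c - s • u) (-u) 0 := fun c => by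
    simpa using ((hasDerivAt_id (0 : ℝ)).smul_const u).const_sub c
  have := (h0 a).inner ℝ (h0 b)
  have e : (inner ℝ (a - (0 : ℝ) • u) (-u) + inner ℝ (-u) (b - (0 : ℝ) • u) : ℝ)
      = -(inner ℝ a u + inner ℝ b u) := by
    simp only [zero_smul, sub_zero, inner_neg_right, inner_neg_left]
    rw [real_inner_comm b u]; ring
  rw [← e]
  exact this

lemma hasDerivAt_XX_line (σ : ℝ) (a b u : E2) :
    HasDerivAt (fun s : ℝ => XX σ (a - s • u) (b - s • u)) (XX σ u (a - b)) 0 := by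
  have e : (fun s : ℝ => XX σ (a - s • u) (b - s • u))
      = fun s : ℝ => XX σ a b + s * XX σ u (a - b) := by
    funext s; simp [XX]; ring
  rw [e]
  simpa using ((hasDerivAt_id (0 : ℝ)).mul_const (XX σ u (a - b))).const_add (XX σ a b)

lemma tan_deriv_bound {σ : ℝ} (hσ : σ ^ 2 = 1) {a b : E2} (hX : 0 < XX σ a b) (u : E2)
    (ha1 : ‖a‖ ≤ 1) (hb1 : ‖b‖ ≤ 1) (hab : ‖a - b‖ ≤ 1) :
    ∃ t' : ℝ, HasDerivAt (fun s : ℝ => XX σ (a - s • u) (b - s • u) /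
        (‖a - s • u‖ * ‖b - s • u‖ + inner ℝ (a - s • u) (b - s • u))) t' 0 ∧
      |t'| ≤ 3 * (1 + Real.tan (InnerProductGeometry.angle a b / 2) ^ 2) *
        (‖a‖⁻¹ * ‖b‖⁻¹) * ‖u‖ := by
  have hD := den_pos hσ hX
  have ha0 : a ≠ 0 := by rintro rfl; simp [XX] at hX
  have hb0 : b ≠ 0 := by rintro rfl; simp [XX] at hX
  have ha : 0 < ‖a‖ := norm_pos_iff.2 ha0
  have hb : 0 < ‖b‖ := norm_pos_iff.2 hb0
  have hder := (hasDerivAt_XX_line σ a b u).div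
    (((hasDerivAt_norm_line ha0 u).mul (hasDerivAt_norm_line hb0 u)).add
      (hasDerivAt_inner_line a b u)) (by simpa using hD.ne')
  refine ⟨_, hder, ?_⟩
  simp only [zero_smul, sub_zero, Pi.add_apply, Pi.mul_apply]
  rw [tan_half_eq hσ hX]
  have hN := XX_sq_add hσ a b
  set N := XX σ a b with hNdef
  set D := ‖a‖ * ‖b‖ + inner ℝ a b with hDdef
  set D' := -(inner ℝ a u / ‖a‖) * ‖b‖ + ‖a‖ * -(inner ℝ b u / ‖b‖) +
    -(inner ℝ a u + inner ℝ b u) with hD'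
  have key : N ^ 2 + D ^ 2 = 2 * (‖a‖ * ‖b‖) * D := by
    have : (inner ℝ a b : ℝ) = D - ‖a‖ * ‖b‖ := by rw [hDdef]; ring
    rw [this] at hN; nlinarith
  have hone : 1 + (N / D) ^ 2 = 2 * (‖a‖ * ‖b‖) / D := by
    field_simp; linarith
  rw [hone]
  have hD'e : D' = -((‖a‖ + ‖b‖) * inner ℝ ((‖a‖⁻¹ • a) + (‖b‖⁻¹ • b)) u) := by
    rw [inner_add_left, real_inner_smul_left, real_inner_smul_left, hD']
    field_simp; ring
  have hU : ‖(‖a‖⁻¹ • a) + (‖b‖⁻¹ • b)‖ ^ 2 = 2 * D / (‖a‖ * ‖b‖) := by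
    rw [norm_add_sq_real, norm_smul, norm_smul, real_inner_smul_left, real_inner_smul_right, hDdef]
    simp
    field_simp
    ring
  have hND : |N * D'| ≤ 4 * D * ‖u‖ := by
    apply abs_le_of_sq_le_sq _ (by positivity)
    have h1 : D' ^ 2 ≤ (‖a‖ + ‖b‖) ^ 2 * ((2 * D / (‖a‖ * ‖b‖)) * ‖u‖ ^ 2) := by
      rw [hD'e, neg_sq, mul_pow, ← hU, ← mul_pow ‖_‖]
      gcongr (‖a‖ + ‖b‖) ^ 2 * ?_
      apply sq_le_sq'
      · have := abs_le.1 (abs_real_inner_le_norm ((‖a‖⁻¹ • a) + (‖b‖⁻¹ • b)) u); linarith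
      · exact real_inner_le_norm _ _
    have h2 : N ^ 2 ≤ 2 * (‖a‖ * ‖b‖) * D := by nlinarith
    have h3 : (‖a‖ + ‖b‖) ^ 2 ≤ 4 := by nlinarith
    calc (N * D') ^ 2 = N ^ 2 * D' ^ 2 := by ring
      _ ≤ (2 * (‖a‖ * ‖b‖) * D) * (4 * ((2 * D / (‖a‖ * ‖b‖)) * ‖u‖ ^ 2)) := by
          gcongr
          exact h1.trans (by gcongr)
      _ = (4 * D * ‖u‖) ^ 2 := by field_simp; ring
  have hN' : |XX σ u (a - b)| ≤ ‖u‖ := by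
    have := abs_XX_le hσ u (a - b)
    nlinarith [norm_nonneg u]
  have : |XX σ u (a - b) * D - N * D'| ≤ 6 * D * ‖u‖ := by
    calc |XX σ u (a - b) * D - N * D'| ≤ |XX σ u (a - b) * D| + |N * D'| := abs_sub _ _
      _ ≤ ‖u‖ * D + 4 * D * ‖u‖ := by
          rw [abs_mul, abs_of_pos hD]; gcongr
      _ ≤ _ := by nlinarith [norm_nonneg u, mul_nonneg hD.le (norm_nonneg u)]
  rw [abs_div, abs_of_pos (pow_pos hD 2)]
  rw [div_le_iff₀ (pow_pos hD 2)]
  refine this.trans (le_of_eq ?_)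
  field_simp
  ring

lemma differentiable_tan {σ : ℝ} (hσ : σ ^ 2 = 1) {p q x : E2} (hX : 0 < XX σ (p - x) (q - x))
    (ha1 : ‖p - x‖ ≤ 1) (hb1 : ‖q - x‖ ≤ 1) (hab : ‖p - q‖ ≤ 1) :
    ∃ L : E2 →L[ℝ] ℝ,
      HasFDerivAt (fun y => Real.tan (InnerProductGeometry.angle (p - y) (q - y) / 2)) L x ∧
      ∀ u, |L u| ≤ 3 * (1 + Real.tan (InnerProductGeometry.angle (p - x) (q - x) / 2) ^ 2) *
        (‖p - x‖⁻¹ * ‖q - x‖⁻¹) * ‖u‖ := by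
  have ha0 : p - x ≠ 0 := by intro h; rw [h] at hX; simp [XX] at hX
  have hb0 : q - x ≠ 0 := by intro h; rw [h] at hX; simp [XX] at hX
  have hXd : Differentiable ℝ (fun y : E2 => XX σ (p - y) (q - y)) := by
    unfold XX; simp only [PiLp.sub_apply]
    fun_prop
  have hev : ∀ᶠ y in nhds x, 0 < XX σ (p - y) (q - y) :=
    hXd.continuous.continuousAt.eventually (lt_mem_nhds hX)
  have heq : (fun y => Real.tan (InnerProductGeometry.angle (p - y) (q - y) / 2)) =ᶠ[nhds x]
      fun y => XX σ (p - y) (q - y) / (‖p - y‖ * ‖q - y‖ + inner ℝ (p - y) (q - y)) := by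
    filter_upwards [hev] with y hy using tan_half_eq hσ hy
  have hp : DifferentiableAt ℝ (fun y : E2 => ‖p - y‖) x :=
    DifferentiableAt.norm ℝ (by fun_prop) ha0
  have hq : DifferentiableAt ℝ (fun y : E2 => ‖q - y‖) x :=
    DifferentiableAt.norm ℝ (by fun_prop) hb0
  have hi : DifferentiableAt ℝ (fun y : E2 => (inner ℝ (p - y) (q - y) : ℝ)) x :=
    DifferentiableAt.inner ℝ (by fun_prop) (by fun_prop)
  have hdiff : DifferentiableAt ℝ (fun y => XX σ (p - y) (q - y) /
      (‖p - y‖ * ‖q - y‖ + inner ℝ (p - y) (q - y))) x := by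
    have h1 := (hp.fun_mul hq).fun_add hi
    have h2 : (fun y : E2 => ‖p - y‖ * ‖q - y‖ + inner ℝ (p - y) (q - y)) x ≠ 0 :=
      (den_pos hσ hX).ne'
    simp only [div_eq_mul_inv]
    exact (hXd x).fun_mul (h1.fun_inv h2)
  refine ⟨_, hdiff.hasFDerivAt.congr_of_eventuallyEq heq, fun u => ?_⟩
  obtain ⟨t', ht', hb⟩ := tan_deriv_bound hσ hX u ha1 hb1 (by simpa using hab)
  have hl : HasDerivAt (fun s : ℝ => x + s • u) u 0 := by
    simpa using ((hasDerivAt_id (0 : ℝ)).smul_const u).const_add x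
  have h2 := HasFDerivAt.comp_hasDerivAt_of_eq (0 : ℝ) hdiff.hasFDerivAt hl (by simp)
  have e : ((fun y => XX σ (p - y) (q - y) /
      (‖p - y‖ * ‖q - y‖ + inner ℝ (p - y) (q - y))) ∘ fun s : ℝ => x + s • u) =
      (fun s : ℝ => XX σ (p - x - s • u) (q - x - s • u) /
        (‖p - x - s • u‖ * ‖q - x - s • u‖ + inner ℝ (p - x - s • u) (q - x - s • u))) := by
    funext s; simp [sub_sub]
  rw [e] at h2
  rw [h2.unique ht']
  exact hb

namespace ConvexPolygon

variable {n : ℕ} [NeZero n] (P : ConvexPolygon n)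

lemma v_mem (i : Fin n) : P.v i ∈ P.region := subset_convexHull ℝ _ ⟨i, rfl⟩

lemma region_convex : Convex ℝ P.region := convex_convexHull ℝ _

lemma region_compact : IsCompact P.region :=
  Set.Finite.isCompact_convexHull ℝ (Set.finite_range _)

lemma mem_of_extreme {S : Set E2} (hS : S ⊆ P.region) (i : Fin n)
    (h : P.v i ∈ convexHull ℝ S) : P.v i ∈ S := by
  have hsub : convexHull ℝ S ⊆ P.region := convexHull_min hS P.region_convex
  exact extremePoints_convexHull_subset
    (inter_extremePoints_subset_extremePoints_of_subset hsub ⟨h, P.extreme i⟩)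

lemma not_wbtw (hinj : Function.Injective P.v) {i j k : Fin n} (hij : i ≠ j) (hjk : j ≠ k) :
    ¬ Wbtw ℝ (P.v i) (P.v j) (P.v k) := by
  intro h
  have h1 : P.v j ∈ convexHull ℝ {P.v i, P.v k} := by
    rw [convexHull_pair]; exact h.mem_segment
  have h2 := P.mem_of_extreme (by
    rintro y (rfl | rfl) <;> exact P.v_mem _) j h1
  rcases h2 with h2 | h2
  · exact hij (hinj h2).symm
  · exact hjk (hinj h2)

lemma not_collinear (hinj : Function.Injective P.v) {i j k : Fin n} (hij : i ≠ j) (hjk : j ≠ k)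
    (hik : i ≠ k) : ¬ Collinear ℝ {P.v i, P.v j, P.v k} := by
  intro h
  rcases h.wbtw_or_wbtw_or_wbtw with h | h | h
  · exact P.not_wbtw hinj hij hjk h
  · exact P.not_wbtw hinj hjk hik.symm h
  · exact P.not_wbtw hinj hik.symm hij h

lemma interior_nonempty (hinj : Function.Injective P.v) {i j k : Fin n} (hij : i ≠ j)
    (hjk : j ≠ k) (hik : i ≠ k) : (interior P.region).Nonempty := by
  have h := affineIndependent_iff_not_collinear_set.2 (P.not_collinear hinj hij hjk hik)
  have h2 := h.affineSpan_eq_top_iff_card_eq_finrank_add_one.2 (by simp)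
  rw [region, interior_convexHull_nonempty_iff_affineSpan_eq_top, eq_top_iff, ← h2]
  apply affineSpan_mono
  rintro y ⟨m, rfl⟩
  fin_cases m <;> simp

lemma XX_ne_zero (hinj : Function.Injective P.v) {i j k : Fin n} (hij : i ≠ j)
    (hjk : j ≠ k) (hik : i ≠ k) {σ : ℝ} (hσ : σ ^ 2 = 1) :
    XX σ (P.v j - P.v i) (P.v k - P.v i) ≠ 0 := by
  intro h
  apply P.not_collinear hinj hij hjk hik
  rw [collinear_iff_of_mem (p₀ := P.v i) (by simp)]
  refine ⟨P.v j - P.v i, ?_⟩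
  have hA : ‖P.v j - P.v i‖ ^ 2 ≠ 0 := by
    have : P.v j - P.v i ≠ 0 := sub_ne_zero.2 fun h => hij (hinj h).symm
    simpa using this
  have hA2 := norm_sq_E2 (P.v j - P.v i)
  have hσ0 : σ ≠ 0 := by rintro rfl; simp at hσ
  have hX : (P.v j - P.v i) 0 * (P.v k - P.v i) 1 - (P.v j - P.v i) 1 * (P.v k - P.v i) 0 = 0 := by
    rcases mul_eq_zero.1 h with h | h
    · exact absurd h hσ0
    · exact h
  rintro p (rfl | rfl | rfl)
  · exact ⟨0, by simp⟩
  · exact ⟨1, by simp⟩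
  · refine ⟨inner ℝ (P.v j - P.v i) (P.v k - P.v i) / ‖P.v j - P.v i‖ ^ 2, ?_⟩
    rw [vadd_eq_add, ← sub_eq_iff_eq_add]
    rw [hA2] at hA ⊢
    rw [inner_E2]
    generalize P.v j - P.v i = A at *
    generalize P.v k - P.v i = B at *
    ext m
    simp only [PiLp.smul_apply, smul_eq_mul]
    rw [div_mul_eq_mul_div, eq_div_iff hA]
    fin_cases m
    · simp; linear_combination (-A 1) * hX
    · simp; linear_combination (A 0) * hX

lemma side_exists (hinj : Function.Injective P.v) (hint : (interior P.region).Nonempty)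
    (i : Fin n) (hi : i ≠ i + 1) :
    ∃ σ : ℝ, (σ = 1 ∨ σ = -1) ∧
      (∀ y ∈ P.region, 0 ≤ XX σ (P.v (i + 1) - P.v i) (y - P.v i)) ∧
      (∀ y ∈ interior P.region, 0 < XX σ (P.v (i + 1) - P.v i) (y - P.v i)) := by
  set A := P.v (i + 1) - P.v i with hA
  have hA0 : A ≠ 0 := sub_ne_zero.2 fun h => hi (hinj h).symm
  set m := midpoint ℝ (P.v i) (P.v (i + 1)) with hm
  have hmf : m ∈ frontier P.region := by
    have : m ∈ ⋃ i, segment ℝ (P.v i) (P.v (i + 1)) :=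
      Set.mem_iUnion.2 ⟨i, midpoint_mem_segment _ _⟩
    rw [← P.boundary] at this
    exact this
  obtain ⟨f, hf⟩ := geometric_hahn_banach_open_point P.region_convex.interior isOpen_interior hmf.2
  have hfK : ∀ y ∈ P.region, f y ≤ f m := by
    intro y hy
    have h1 : y ∈ closure (interior P.region) := by
      rw [P.region_convex.closure_interior_eq_closure_of_nonempty_interior hint]
      exact subset_closure hy
    have h2 : closure (interior P.region) ⊆ {y | f y ≤ f m} :=
      closure_minimal (fun y hy => (hf y hy).le) (isClosed_le f.continuous continuous_const)
    exact h2 h1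
  have hmid : f m = (f (P.v i) + f (P.v (i + 1))) / 2 := by
    rw [hm, midpoint_eq_smul_add, map_smul, map_add]; simp; ring
  have h1 := hfK _ (P.v_mem i)
  have h2 := hfK _ (P.v_mem (i + 1))
  have hv : f (P.v i) = f m := by linarith
  have hfA : f A = 0 := by rw [hA, map_sub]; linarith
  set J : E2 := !₂[-A 1, A 0] with hJ
  have hz : ∀ z : E2, f z * ‖A‖ ^ 2 = XX 1 A z * f J := by
    intro z
    have e : (‖A‖ ^ 2) • z = (inner ℝ A z : ℝ) • A + (XX 1 A z) • J := by
      rw [norm_sq_E2, inner_E2]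
      ext k
      fin_cases k <;> simp [XX, hJ] <;> ring
    have := congrArg f e
    rw [map_smul, map_add, map_smul, map_smul, hfA] at this
    simp only [smul_eq_mul, mul_zero, zero_add] at this
    linarith
  have hpos : 0 < ‖A‖ ^ 2 := by have := norm_pos_iff.2 hA0; positivity
  have hK2 : ∀ y ∈ P.region, XX 1 A (y - P.v i) * f J ≤ 0 := by
    intro y hy
    rw [← hz, map_sub]
    have := hfK y hy
    exact mul_nonpos_of_nonpos_of_nonneg (by linarith) hpos.le
  have hI2 : ∀ y ∈ interior P.region, XX 1 A (y - P.v i) * f J < 0 := by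
    intro y hy
    rw [← hz, map_sub]
    have := hf y hy
    exact mul_neg_of_neg_of_pos (by linarith) hpos
  have hneg : ∀ z, XX (-1) A z = - XX 1 A z := by intro z; simp [XX]
  rcases lt_trichotomy (f J) 0 with h | h | h
  · refine ⟨1, Or.inl rfl, fun y hy => ?_, fun y hy => ?_⟩
    · by_contra hc; push Not at hc; nlinarith [hK2 y hy]
    · by_contra hc; push Not at hc; nlinarith [hI2 y hy]
  · obtain ⟨y, hy⟩ := hint
    have := hI2 y hy
    rw [h] at this; simp at this
  · refine ⟨-1, Or.inr rfl, fun y hy => ?_, fun y hy => ?_⟩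
    · rw [hneg]; by_contra hc; push Not at hc; nlinarith [hK2 y hy]
    · rw [hneg]; by_contra hc; push Not at hc; nlinarith [hI2 y hy]

end ConvexPolygon

namespace ConvexPolygon

variable {n : ℕ} [NeZero n]

lemma fin_one_ne (hn : 3 ≤ n) : (1 : Fin n) ≠ 0 := by
  intro h
  have := congrArg Fin.val h
  rw [Fin.val_one', Nat.mod_eq_of_lt (by omega)] at this
  simp at this

lemma fin_two_ne (hn : 3 ≤ n) : (1 + 1 : Fin n) ≠ 0 := by
  intro h
  have := congrArg Fin.val h
  rw [Fin.val_add, Fin.val_one', Nat.mod_eq_of_lt (a := 1) (by omega),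
    Nat.mod_eq_of_lt (by omega)] at this
  simp at this

lemma fin_ne_succ (hn : 3 ≤ n) (i : Fin n) : i ≠ i + 1 := by
  intro h; exact fin_one_ne hn (by simpa using h)

lemma fin_ne_succ2 (hn : 3 ≤ n) (i : Fin n) : i ≠ i + 1 + 1 := by
  intro h
  rw [add_assoc] at h
  exact fin_two_ne hn (by simpa using h)

/-- The geometric facts extracted from the polygon. -/
structure Good (P : ConvexPolygon n) (σ ρ d : ℝ) (c : E2) : Prop where
  hσ : σ ^ 2 = 1
  hρ : 0 < ρ
  hρ1 : ρ ≤ 1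
  hd : 0 < d
  hd1 : d ≤ 1
  side : ∀ i, ∀ y ∈ P.region, 0 ≤ XX σ (P.v (i + 1) - P.v i) (y - P.v i)
  sideint : ∀ i, ∀ y ∈ interior P.region, 0 < XX σ (P.v (i + 1) - P.v i) (y - P.v i)
  inc : ∀ i, ρ * ‖P.v (i + 1) - P.v i‖ ≤ XX σ (P.v (i + 1) - P.v i) (c - P.v i)
  sep : ∀ i j, i ≠ j → d ≤ ‖P.v i - P.v j‖
  bd : ∀ y ∈ P.region, ∀ z ∈ P.region, ‖y - z‖ ≤ 1
  cmem : c ∈ P.region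
  ext : ∀ a p : Fin n, p ≠ a → p ≠ a + 1 →
    0 ≤ XX σ (c - P.v (a + 1)) (P.v p - P.v (a + 1)) →
    0 ≤ XX σ (P.v p - P.v a) (c - P.v a) → False

lemma exists_orient (P : ConvexPolygon n) (hinj : Function.Injective P.v) :
    ∃ σ : ℝ, (σ = 1 ∨ σ = -1) ∧
      (∀ i, ∀ y ∈ P.region, 0 ≤ XX σ (P.v (i + 1) - P.v i) (y - P.v i)) ∧
      (∀ i, ∀ y ∈ interior P.region, 0 < XX σ (P.v (i + 1) - P.v i) (y - P.v i)) := by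
  have hn := P.hn
  have hint := P.interior_nonempty hinj (fin_ne_succ hn 0) (fin_ne_succ hn _) (fin_ne_succ2 hn 0)
  choose s hs1 hs2 hs3 using fun i => P.side_exists hinj hint i (fin_ne_succ hn i)
  have hsq : ∀ i, s i ^ 2 = 1 := fun i => by rcases hs1 i with h | h <;> rw [h] <;> norm_num
  have hstep : ∀ i, s (i + 1) = s i := by
    intro i
    have h1 := hs2 i _ (P.v_mem (i + 1 + 1))
    have h2 := hs2 (i + 1) _ (P.v_mem i)
    have h3 := P.XX_ne_zero hinj (fin_ne_succ hn i) (fin_ne_succ hn (i + 1)) (fin_ne_succ2 hn i)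
      (hsq i)
    have h1' := lt_of_le_of_ne h1 h3.symm
    generalize P.v i = a at *
    generalize P.v (i + 1 + 1) = b at *
    generalize P.v (i + 1) = e at *
    simp only [XX, PiLp.sub_apply] at h1' h2
    rcases hs1 i with h | h <;> rcases hs1 (i + 1) with h' | h' <;> rw [h, h'] <;>
      rw [h] at h1' <;> rw [h'] at h2 <;> exfalso <;> nlinarith
  have hall : ∀ k : ℕ, s (Fin.ofNat n k) = s 0 := by
    intro k
    induction k with
    | zero => rfl
    | succ k ih =>
      rw [← ih, ← hstep (Fin.ofNat n k)]
      congr 1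
      ext
      simp [Fin.val_add, Fin.ofNat]
  have hall' : ∀ i, s i = s 0 := by
    intro i
    have := hall i.val
    rwa [show Fin.ofNat n i.val = i from by ext; simp [Fin.ofNat, Nat.mod_eq_of_lt i.2]] at this
  refine ⟨s 0, hs1 0, fun i => ?_, fun i => ?_⟩
  · rw [← hall' i]; exact hs2 i
  · rw [← hall' i]; exact hs3 i

lemma exists_good (P : ConvexPolygon n) {γ d : ℝ} (hγ : 0 < γ) (hd : 0 < d)
    (hdiam : Metric.diam P.region = 1) (h1 : P.G1 γ) (h2 : P.G2 d) :
    ∃ σ c, Good P σ (min 1 (1 / γ)) (min 1 d) c := by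
  have hn := P.hn
  have hinj : Function.Injective P.v := by
    intro i j hij
    by_contra hne
    have := h2 i j hne
    rw [hij, dist_self] at this
    linarith
  have hint := P.interior_nonempty hinj (fin_ne_succ hn 0) (fin_ne_succ hn _) (fin_ne_succ2 hn 0)
  have hbd : ∀ y ∈ P.region, ∀ z ∈ P.region, ‖y - z‖ ≤ 1 := by
    intro y hy z hz
    rw [← dist_eq_norm, ← hdiam]
    exact Metric.dist_le_diam_of_mem P.region_compact.isBounded hy hz
  obtain ⟨c, hc, ρ, hρ, hball⟩ : ∃ c ∈ P.region, ∃ ρ, 1 / γ ≤ ρ ∧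
      Metric.closedBall c ρ ⊆ P.region := by
    have hbdd : BddAbove {r : ℝ | ∃ c : E2, Metric.closedBall c r ⊆ P.region} := by
      refine ⟨1, ?_⟩
      rintro r ⟨c, hc⟩
      rcases le_total r 0 with hr | hr
      · linarith
      have hc1 : c ∈ P.region := hc (Metric.mem_closedBall_self hr)
      have hc2 : c + r • (EuclideanSpace.single (0 : Fin 2) (1 : ℝ)) ∈ P.region := by
        apply hc
        rw [Metric.mem_closedBall, dist_eq_norm]
        simp [norm_smul, abs_of_nonneg hr]
      have := hbd _ hc2 _ hc1
      simpa [norm_smul, abs_of_nonneg hr] using this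
    have hpos : 0 < P.inradius := by
      obtain ⟨y, hy⟩ := hint
      obtain ⟨ε, hε, hb⟩ := Metric.isOpen_iff.1 isOpen_interior y hy
      have hmem : ε / 2 ∈ {r : ℝ | ∃ c : E2, Metric.closedBall c r ⊆ P.region} :=
        ⟨y, (Metric.closedBall_subset_ball (by linarith)).trans (hb.trans interior_subset)⟩
      have := le_csSup hbdd hmem
      have h3 : ε / 2 ≤ P.inradius := this
      linarith
    have hlt : 1 / γ < P.inradius := by
      have : Metric.diam P.region / P.inradius < γ := h1
      rw [hdiam, div_lt_iff₀ hpos] at this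
      rw [div_lt_iff₀ hγ]; linarith
    obtain ⟨r, ⟨c, hc⟩, hr⟩ := exists_lt_of_lt_csSup (by
      by_contra hne
      rw [Set.not_nonempty_iff_eq_empty] at hne
      rw [inradius, hne, Real.sSup_empty] at hpos
      exact lt_irrefl _ hpos) hlt
    have h0 : 0 < 1 / γ := by positivity
    exact ⟨c, hc (Metric.mem_closedBall_self (by linarith)), r, hr.le, hc⟩
  obtain ⟨σ, hσ, hside, hsideint⟩ := P.exists_orient hinj
  have hσ2 : σ ^ 2 = 1 := by rcases hσ with h | h <;> rw [h] <;> norm_num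
  have hρ0 : 0 < ρ := lt_of_lt_of_le (by positivity) hρ
  have hinc : ∀ i, ρ * ‖P.v (i + 1) - P.v i‖ ≤ XX σ (P.v (i + 1) - P.v i) (c - P.v i) := by
    intro i
    have hA0 : P.v (i + 1) - P.v i ≠ 0 := sub_ne_zero.2 fun h => fin_ne_succ hn i (hinj h).symm
    have hs := hside i
    generalize P.v (i + 1) - P.v i = A at *
    have hA : 0 < ‖A‖ := norm_pos_iff.2 hA0
    have hAs := norm_sq_E2 A
    set J : E2 := !₂[-A 1, A 0] with hJ
    have hJn : ‖J‖ = ‖A‖ := by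
      have : ‖J‖ ^ 2 = ‖A‖ ^ 2 := by rw [norm_sq_E2, norm_sq_E2, hJ]; simp; ring
      rwa [sq_eq_sq₀ (norm_nonneg _) (norm_nonneg _)] at this
    have hy : c - (ρ * σ / ‖A‖) • J ∈ P.region := by
      apply hball
      rw [Metric.mem_closedBall, dist_eq_norm]
      have : |σ| = 1 := by rcases hσ with h | h <;> rw [h] <;> simp
      simp [norm_smul, hJn, this, abs_of_pos hρ0]
      field_simp; rfl
    have h := hs _ hy
    have e : XX σ A (c - (ρ * σ / ‖A‖) • J - P.v i) = XX σ A (c - P.v i) - ρ * ‖A‖ := by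
      have e1 : c - (ρ * σ / ‖A‖) • J - P.v i = (c - P.v i) - (ρ * σ / ‖A‖) • J := by abel
      rw [e1, XX_sub_right, XX_smul_right]
      congr 1
      have e2 : XX σ A J = σ * ‖A‖ ^ 2 := by rw [hAs]; show σ * (A 0 * A 0 - A 1 * -A 1) = _; ring
      rw [e2]
      have e3 : ρ * σ / ‖A‖ * (σ * ‖A‖ ^ 2) = ρ * σ ^ 2 * ‖A‖ := by field_simp
      rw [e3, hσ2, mul_one]
    linarith
  have hdpos : ∀ i j, i ≠ j → d ≤ ‖P.v i - P.v j‖ := by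
    intro i j hij
    rw [← dist_eq_norm]; exact (h2 i j hij).le
  refine ⟨σ, c, hσ2, lt_min one_pos (by positivity), min_le_left _ _, lt_min one_pos hd,
    min_le_left _ _, hside, hsideint, ?_, ?_, hbd, hc, ?_⟩
  · intro i
    refine le_trans ?_ (hinc i)
    gcongr
    exact (min_le_right _ _).trans hρ
  · intro i j hij
    exact (min_le_right _ _).trans (hdpos i j hij)
  · intro a p hpa hpa1 hx1 hx2
    have hT : 0 < XX σ (P.v (a + 1) - P.v a) (c - P.v a) := by
      refine lt_of_lt_of_le ?_ (hinc a)
      exact mul_pos hρ0 (lt_of_lt_of_le hd (hdpos _ _ (fin_ne_succ hn a).symm))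
    have hx3 := hside a _ (P.v_mem p)
    have hmem : P.v p ∈ convexHull ℝ {P.v a, P.v (a + 1), c} := by
      have hcv := convex_convexHull ℝ ({P.v a, P.v (a + 1), c} : Set E2)
      have hsub := subset_convexHull ℝ ({P.v a, P.v (a + 1), c} : Set E2)
      set T := XX σ (P.v (a + 1) - P.v a) (c - P.v a) with hTdef
      have h3 := hcv.sum_mem (t := Finset.univ) (w := ![XX σ (c - P.v (a + 1)) (P.v p - P.v (a + 1)) / T,
          XX σ (P.v p - P.v a) (c - P.v a) / T, XX σ (P.v (a + 1) - P.v a) (P.v p - P.v a) / T])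
          (z := ![P.v a, P.v (a + 1), c]) (by
            intro i _; fin_cases i <;> simp <;> positivity) (by
            simp [Fin.sum_univ_three]
            rw [← add_div, ← add_div, div_eq_one_iff_eq hT.ne', hTdef]
            simp [XX]; ring) (by
            intro i _; fin_cases i <;> simp <;> apply hsub <;> simp)
      convert h3 using 1
      simp [Fin.sum_univ_three]
      have e : T • P.v p = XX σ (c - P.v (a + 1)) (P.v p - P.v (a + 1)) • P.v a +
        XX σ (P.v p - P.v a) (c - P.v a) • P.v (a + 1) +
        XX σ (P.v (a + 1) - P.v a) (P.v p - P.v a) • c := by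
        ext i
        fin_cases i <;> simp [hTdef, XX] <;> ring
      have e2 : P.v p = T⁻¹ • (T • P.v p) := by rw [smul_smul, inv_mul_cancel₀ hT.ne', one_smul]
      refine e2.trans ?_
      rw [e]
      simp only [smul_add, smul_smul, div_eq_inv_mul]
    have := P.mem_of_extreme (by
      rintro y (rfl | rfl | rfl)
      · exact P.v_mem _
      · exact P.v_mem _
      · exact hc) p hmem
    rcases this with h | h | h
    · exact hpa (hinj h)
    · exact hpa1 (hinj h)
    · have h4 := hinc p
      rw [Set.mem_singleton_iff] at h
      rw [h, sub_self] at h4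
      have h5 : 0 < ρ * ‖P.v (p + 1) - P.v p‖ :=
        mul_pos hρ0 (lt_of_lt_of_le hd (hdpos _ _ (fin_ne_succ hn p).symm))
      rw [h] at h5
      simp [XX] at h4
      linarith

end ConvexPolygon

lemma far_gamma {σ : ℝ} (hσ : σ ^ 2 = 1) {ra ra' m ε : ℝ} {g η C : E2}
    (hra : 0 ≤ ra) (hra' : 0 ≤ ra') (hra1 : ra ≤ 1) (hra1' : ra' ≤ 1)
    (hg : ‖g‖ = 1) (hη : ‖η‖ ≤ ε) (hC : ‖C‖ ≤ 1) (hm : 0 < m) (hε : ε ≤ m)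
    (h : 4 * m ≤ XX σ (ra' • g - ra • (η - g)) (C - ra • (η - g))) :
    m ≤ XX σ g C := by
  have hε0 : 0 ≤ ε := (norm_nonneg _).trans hη
  have e : XX σ (ra' • g - ra • (η - g)) (C - ra • (η - g)) =
      (ra + ra') * XX σ g C - ra * ra' * XX σ g η - ra * XX σ η C := by
    simp [XX]; ring
  have b1 : |XX σ g η| ≤ ε := (abs_XX_le hσ g η).trans (by rw [hg, one_mul]; exact hη)
  have b2 : |XX σ η C| ≤ ε := (abs_XX_le hσ η C).trans (by nlinarith [norm_nonneg C])
  have c1 : |ra * ra' * XX σ g η| ≤ ε := by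
    rw [abs_mul, abs_of_nonneg (mul_nonneg hra hra')]
    nlinarith [mul_le_one₀ hra1 hra' hra1', abs_nonneg (XX σ g η)]
  have c2 : |ra * XX σ η C| ≤ ε := by
    rw [abs_mul, abs_of_nonneg hra]
    nlinarith [abs_nonneg (XX σ η C)]
  rw [e] at h
  have d1 := abs_le.1 c1
  have d2 := abs_le.1 c2
  have h3 : 2 * m ≤ (ra + ra') * XX σ g C := by linarith
  rcases le_total (XX σ g C) 0 with h0 | h0
  · nlinarith
  · nlinarith

lemma far_kappa {σ : ℝ} (hσ : σ ^ 2 = 1) {ra ra' rb' h ε e2 : ℝ} {g k η : E2}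
    (hra : h ≤ ra) (hra' : h ≤ ra') (hrb' : h ≤ rb') (hra1 : ra ≤ 1) (hra1' : ra' ≤ 1)
    (hrb1' : rb' ≤ 1) (hh : 0 < h)
    (hg : ‖g‖ = 1) (hk : ‖k‖ = 1) (hη : ‖η‖ ≤ ε) (hε : ε ≤ h ^ 2 * e2)
    (hs : 0 ≤ XX σ (ra' • g - ra • (η - g)) (rb' • k - ra • (η - g))) :
    -e2 ≤ XX σ g k := by
  have hε0 : 0 ≤ ε := (norm_nonneg _).trans hη
  have e : XX σ (ra' • g - ra • (η - g)) (rb' • k - ra • (η - g)) =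
      (ra + ra') * rb' * XX σ g k - ra * ra' * XX σ g η - ra * rb' * XX σ η k := by
    simp [XX]; ring
  have b1 : |XX σ g η| ≤ ε := (abs_XX_le hσ g η).trans (by rw [hg, one_mul]; exact hη)
  have b2 : |XX σ η k| ≤ ε := (abs_XX_le hσ η k).trans (by rw [hk, mul_one]; exact hη)
  have c1 : |ra * ra' * XX σ g η| ≤ ε := by
    rw [abs_mul, abs_of_nonneg (mul_nonneg (by linarith) (by linarith))]
    nlinarith [mul_le_one₀ hra1 (by linarith) hra1', abs_nonneg (XX σ g η)]
  have c2 : |ra * rb' * XX σ η k| ≤ ε := by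
    rw [abs_mul, abs_of_nonneg (mul_nonneg (by linarith) (by linarith))]
    nlinarith [mul_le_one₀ hra1 (by linarith) hrb1', abs_nonneg (XX σ η k)]
  rw [e] at hs
  have d1 := abs_le.1 c1
  have d2 := abs_le.1 c2
  have h3 : -(2 * ε) ≤ (ra + ra') * rb' * XX σ g k := by linarith
  have h4 : 2 * h ^ 2 ≤ (ra + ra') * rb' := by nlinarith
  by_contra hc
  push Not at hc
  have he2 : 0 ≤ e2 := by
    by_contra hneg
    push Not at hneg
    nlinarith [pow_pos hh 2]
  nlinarith [pow_pos hh 2]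

lemma far_half {σ : ℝ} (hσ : σ ^ 2 = 1) {ra ra' rb h m ε e2 : ℝ} {g k η ζ C : E2}
    (hra : h ≤ ra) (hra' : h ≤ ra') (hrb : h ≤ rb) (hra1 : ra ≤ 1) (hra1' : ra' ≤ 1)
    (hrb1 : rb ≤ 1) (hh : 0 < h) (hg : ‖g‖ = 1) (hk : ‖k‖ = 1) (hη : ‖η‖ ≤ ε) (hζ : ‖ζ‖ ≤ ε)
    (hε1 : ε ≤ 1) (hC : ‖C‖ ≤ 1) (hm : 0 < m)
    (hγ : m ≤ XX σ g C) (hχ : m ≤ XX σ k C) (hκ : |XX σ g k| ≤ e2)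
    (hsmall : 2 * ε + e2 ≤ 2 * h * m)
    (hext : 0 ≤ XX σ (C - ra' • g) (rb • (ζ - k) - ra' • g) →
      0 ≤ XX σ (rb • (ζ - k) - ra • (η - g)) (C - ra • (η - g)) → False) :
    ra * XX σ g C - rb * XX σ k C ≤ e2 + 5 * ε := by
  have hε0 : 0 ≤ ε := (norm_nonneg _).trans hη
  have bnd : ∀ {s : ℝ} {u v : E2}, 0 ≤ s → s ≤ 1 → ‖u‖ ≤ ε → ‖v‖ ≤ 1 → |s * XX σ u v| ≤ ε := by
    intro s u v h0 h1 hu hv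
    rw [abs_mul, abs_of_nonneg h0]
    have := abs_XX_le hσ u v
    have h2 : ‖u‖ * ‖v‖ ≤ ε := by nlinarith [norm_nonneg u, norm_nonneg v]
    nlinarith [abs_nonneg (XX σ u v)]
  have hra0 : 0 ≤ ra := by linarith
  have hra0' : 0 ≤ ra' := by linarith
  have hrb0 : 0 ≤ rb := by linarith
  have hκ' : ∀ {s : ℝ}, 0 ≤ s → s ≤ 1 → |s * XX σ g k| ≤ e2 := by
    intro s h0 h1
    rw [abs_mul, abs_of_nonneg h0]
    nlinarith [abs_nonneg (XX σ g k)]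
  have e1 : XX σ (C - ra' • g) (rb • (ζ - k) - ra' • g) =
      rb * XX σ k C + ra' * XX σ g C - rb * XX σ ζ C + ra' * rb * XX σ ζ g
        + ra' * rb * XX σ g k := by simp [XX]; ring
  have e2' : XX σ (rb • (ζ - k) - ra • (η - g)) (C - ra • (η - g)) =
      ra * XX σ g C - rb * XX σ k C + rb * XX σ ζ C - ra * XX σ η C
        - rb * ra * XX σ ζ η + rb * ra * XX σ ζ g - rb * ra * XX σ η k
        + rb * ra * XX σ g k := by simp [XX]; ring
  by_contra hc
  push Not at hc
  apply hext
  · rw [e1]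
    have h1 := abs_le.1 (bnd hrb0 hrb1 hζ hC)
    have h2 := abs_le.1 (bnd (mul_nonneg hra0' hrb0) (mul_le_one₀ hra1' hrb0 hrb1) hζ hg.le)
    have h3 := abs_le.1 (hκ' (mul_nonneg hra0' hrb0) (mul_le_one₀ hra1' hrb0 hrb1))
    have h4 : h * m ≤ rb * XX σ k C := by gcongr
    have h5 : h * m ≤ ra' * XX σ g C := by gcongr
    linarith
  · rw [e2']
    have hp0 := mul_nonneg hrb0 hra0
    have hp1 := mul_le_one₀ hrb1 hra0 hra1
    have h1 := abs_le.1 (bnd hrb0 hrb1 hζ hC)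
    have h2 := abs_le.1 (bnd hra0 hra1 hη hC)
    have h3 := abs_le.1 (bnd hp0 hp1 hζ (hη.trans hε1))
    have h4 := abs_le.1 (bnd hp0 hp1 hζ hg.le)
    have h5 := abs_le.1 (bnd hp0 hp1 hη hk.le)
    have h6 := abs_le.1 (hκ' hp0 hp1)
    linarith

lemma far_final {σ : ℝ} (hσ : σ ^ 2 = 1) {ra rb d m ε e2 : ℝ} {g k η ζ C : E2}
    (hra : 0 ≤ ra) (hrb : 0 ≤ rb) (hra1 : ra ≤ 1)
    (hrb1 : rb ≤ 1) (hg : ‖g‖ = 1) (hη : ‖η‖ ≤ ε) (hζ : ‖ζ‖ ≤ ε)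
    (hC : ‖C‖ ≤ 1) (hm : 0 < m)
    (hγ : m ≤ XX σ g C) (hκ : |XX σ g k| ≤ e2)
    (h1 : ra * XX σ g C - rb * XX σ k C ≤ e2 + 5 * ε)
    (h2 : rb * XX σ k C - ra * XX σ g C ≤ e2 + 5 * ε)
    (hd : d ≤ ‖ra • (η - g) - rb • (ζ - k)‖) (hsmall : 2 * e2 + 9 * ε < d * m) :
    False := by
  have hε0 : 0 ≤ ε := (norm_nonneg _).trans hη
  have bnd : ∀ {s : ℝ} {u v : E2}, 0 ≤ s → s ≤ 1 → ‖u‖ ≤ ε → ‖v‖ ≤ 1 → |s * XX σ u v| ≤ ε := by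
    intro s u v h0 h1 hu hv
    rw [abs_mul, abs_of_nonneg h0]
    have := abs_XX_le hσ u v
    have h2 : ‖u‖ * ‖v‖ ≤ ε := by nlinarith [norm_nonneg u, norm_nonneg v]
    nlinarith [abs_nonneg (XX σ u v)]
  set V := ra • (η - g) - rb • (ζ - k) with hV
  have key := norm_mul_XX_le σ g C V
  have eA : XX σ V C = ra * XX σ η C - ra * XX σ g C - rb * XX σ ζ C + rb * XX σ k C := by
    simp [hV, XX]; ring
  have eB : XX σ g V = -(ra * XX σ η g) + rb * XX σ ζ g + rb * XX σ g k := by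
    simp [hV, XX]; ring
  have a1 := abs_le.1 (bnd hra hra1 hη hC)
  have a2 := abs_le.1 (bnd hrb hrb1 hζ hC)
  have a3 := abs_le.1 (bnd hra hra1 hη hg.le)
  have a4 := abs_le.1 (bnd hrb hrb1 hζ hg.le)
  have a5 : |rb * XX σ g k| ≤ e2 := by
    rw [abs_mul, abs_of_nonneg hrb]; nlinarith [abs_nonneg (XX σ g k)]
  have a5 := abs_le.1 a5
  have k1 : |XX σ V C| ≤ e2 + 7 * ε := by
    rw [eA, abs_le]; constructor <;> linarith
  have k2 : |XX σ g V| ≤ e2 + 2 * ε := by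
    rw [eB, abs_le]; constructor <;> linarith
  have k3 : ‖C‖ * |XX σ g V| ≤ e2 + 2 * ε := by nlinarith [abs_nonneg (XX σ g V), norm_nonneg C]
  rw [hg, one_mul] at key
  have : d * m ≤ ‖V‖ * XX σ g C := by gcongr
  linarith

namespace ConvexPolygon

variable {n : ℕ} [NeZero n]

def rr (P : ConvexPolygon n) (x : E2) (i : Fin n) : ℝ := ‖P.v i - x‖
def uu (P : ConvexPolygon n) (x : E2) (i : Fin n) : E2 := ‖P.v i - x‖⁻¹ • (P.v i - x)

lemma r_eq (P : ConvexPolygon n) (x : E2) (i : Fin n) : P.r i x = P.rr x i := by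
  rw [r, rr, dist_comm, dist_eq_norm]

lemma t_eq (P : ConvexPolygon n) (x : E2) (i : Fin n) :
    P.t i x = Real.tan (InnerProductGeometry.angle (P.v i - x) (P.v (i + 1) - x) / 2) := rfl

lemma t_nonneg (P : ConvexPolygon n) (x : E2) (i : Fin n) : 0 ≤ P.t i x := by
  rw [t_eq]; exact tan_half_nonneg _ _

section
variable {P : ConvexPolygon n} {σ ρ d : ℝ} {c x : E2}

lemma Good.pos (G : Good P σ ρ d c) (hx : x ∈ interior P.region) (i : Fin n) :
    0 < XX σ (P.v i - x) (P.v (i + 1) - x) := by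
  have h := G.sideint i x hx
  have e : XX σ (P.v i - x) (P.v (i + 1) - x) = XX σ (P.v (i + 1) - P.v i) (x - P.v i) := by
    simp only [XX, PiLp.sub_apply]; ring
  rwa [e]

lemma Good.ne (G : Good P σ ρ d c) (hx : x ∈ interior P.region) (i : Fin n) :
    P.v i - x ≠ 0 := by
  intro h
  have h2 := G.pos hx i
  rw [h] at h2
  simp [XX] at h2

lemma Good.rr_pos (G : Good P σ ρ d c) (hx : x ∈ interior P.region) (i : Fin n) :
    0 < P.rr x i := norm_pos_iff.2 (G.ne hx i)

lemma Good.rr_le (G : Good P σ ρ d c) (hx : x ∈ interior P.region) (i : Fin n) :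
    P.rr x i ≤ 1 := G.bd _ (P.v_mem i) _ (interior_subset hx)

lemma Good.uu_norm (G : Good P σ ρ d c) (hx : x ∈ interior P.region) (i : Fin n) :
    ‖P.uu x i‖ = 1 := by
  have := G.rr_pos hx i
  rw [rr] at this
  rw [uu, norm_smul, norm_inv, norm_norm, inv_mul_cancel₀ this.ne']

lemma Good.v_eq (G : Good P σ ρ d c) (hx : x ∈ interior P.region) (i : Fin n) :
    P.v i - x = P.rr x i • P.uu x i := by
  have := G.rr_pos hx i
  rw [rr] at this
  rw [uu, rr, smul_smul, mul_inv_cancel₀ this.ne', one_smul]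

lemma Good.v_sub (G : Good P σ ρ d c) (hx : x ∈ interior P.region) (i j : Fin n) :
    P.v i - P.v j = P.rr x i • P.uu x i - P.rr x j • P.uu x j := by
  rw [← G.v_eq hx, ← G.v_eq hx]; abel

lemma Good.small (G : Good P σ ρ d c) (hx : x ∈ interior P.region) (i : Fin n) {ε M : ℝ}
    (hM : 0 < M) (hε : 2 ≤ ε * M) (h : M < P.t i x) : ‖P.uu x i + P.uu x (i + 1)‖ ≤ ε := by
  have := tan_mul_unit_add (G.ne hx i) (G.ne hx (i + 1))
  rw [← t_eq] at this
  change P.t i x * ‖P.uu x i + P.uu x (i + 1)‖ ≤ 2 at this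
  by_contra hc
  push Not at hc
  nlinarith [norm_nonneg (P.uu x i + P.uu x (i + 1))]

lemma Good.close (G : Good P σ ρ d c) (hx : x ∈ interior P.region) (i : Fin n) :
    ‖P.uu x i - P.uu x (i + 1)‖ ≤ 2 * P.t i x := unit_sub_le_tan (G.pos hx i)

lemma Good.wedge' (G : Good P σ ρ d c) (q : Fin n) {g : E2} {s s' : ℝ} (hs : 0 ≤ s) (hs' : 0 ≤ s')
    (h1 : ‖(P.v (q + 1 + 1) - P.v (q + 1)) - s • g‖ < ρ * d)
    (h2 : ‖(P.v q - P.v (q + 1)) - s' • g‖ < ρ * d) : False := by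
  have hn := P.hn
  have s1 := G.sep (q + 1 + 1) (q + 1) (fin_ne_succ hn (q + 1)).symm
  have s2 := G.sep q (q + 1) (fin_ne_succ hn q)
  have i1 := G.inc (q + 1)
  have i2 := G.inc q
  refine wedge (C := c - P.v (q + 1)) G.hσ (G.bd _ G.cmem _ (P.v_mem _)) i1 (B := P.v q - P.v (q + 1)) ?_
    hs hs' (lt_of_lt_of_le h1 ?_) (lt_of_lt_of_le h2 ?_)
  · rw [norm_sub_rev]
    refine i2.trans (le_of_eq ?_)
    simp only [XX, PiLp.sub_apply]; ring
  · exact mul_le_mul_of_nonneg_left s1 G.hρ.le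
  · exact mul_le_mul_of_nonneg_left s2 G.hρ.le

lemma Good.F2 (G : Good P σ ρ d c) (hx : x ∈ interior P.region) (q : Fin n)
    (h1 : P.rr x (q + 1) ≤ P.rr x q) (h2 : P.rr x (q + 1) ≤ P.rr x (q + 1 + 1)) :
    ρ * d / 2 ≤ P.t q x ∨ ρ * d / 2 ≤ P.t (q + 1) x := by
  by_contra hc
  push Not at hc
  obtain ⟨hc1, hc2⟩ := hc
  have k1 := G.close hx q
  have k2 := G.close hx (q + 1)
  refine G.wedge' q (g := P.uu x (q + 1)) (sub_nonneg.2 h2) (sub_nonneg.2 h1) ?_ ?_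
  · rw [G.v_sub hx]
    have e : P.rr x (q + 1 + 1) • P.uu x (q + 1 + 1) - P.rr x (q + 1) • P.uu x (q + 1) -
        (P.rr x (q + 1 + 1) - P.rr x (q + 1)) • P.uu x (q + 1) =
        P.rr x (q + 1 + 1) • (P.uu x (q + 1 + 1) - P.uu x (q + 1)) := by module
    rw [e, norm_smul, Real.norm_of_nonneg (G.rr_pos hx _).le, norm_sub_rev]
    nlinarith [G.rr_le hx (q + 1 + 1), norm_nonneg (P.uu x (q + 1) - P.uu x (q + 1 + 1))]
  · rw [G.v_sub hx]
    have e : P.rr x q • P.uu x q - P.rr x (q + 1) • P.uu x (q + 1) -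
        (P.rr x q - P.rr x (q + 1)) • P.uu x (q + 1) =
        P.rr x q • (P.uu x q - P.uu x (q + 1)) := by module
    rw [e, norm_smul, Real.norm_of_nonneg (G.rr_pos hx _).le]
    nlinarith [G.rr_le hx q, norm_nonneg (P.uu x q - P.uu x (q + 1))]

lemma Good.F3adj (G : Good P σ ρ d c) (hx : x ∈ interior P.region) (q : Fin n) {ε : ℝ}
    (hε : ε < ρ * d) (h1 : ‖P.uu x q + P.uu x (q + 1)‖ ≤ ε)
    (h2 : ‖P.uu x (q + 1) + P.uu x (q + 1 + 1)‖ ≤ ε) : False := by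
  refine G.wedge' q (g := - P.uu x (q + 1)) (s := P.rr x (q + 1 + 1) + P.rr x (q + 1))
    (s' := P.rr x q + P.rr x (q + 1)) ?_ ?_ ?_ ?_
  · linarith [G.rr_pos hx (q + 1 + 1), G.rr_pos hx (q + 1)]
  · linarith [G.rr_pos hx q, G.rr_pos hx (q + 1)]
  · rw [G.v_sub hx]
    have e : P.rr x (q + 1 + 1) • P.uu x (q + 1 + 1) - P.rr x (q + 1) • P.uu x (q + 1) -
        (P.rr x (q + 1 + 1) + P.rr x (q + 1)) • -P.uu x (q + 1) =
        P.rr x (q + 1 + 1) • (P.uu x (q + 1) + P.uu x (q + 1 + 1)) := by module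
    rw [e, norm_smul, Real.norm_of_nonneg (G.rr_pos hx _).le]
    nlinarith [G.rr_le hx (q + 1 + 1), norm_nonneg (P.uu x (q + 1) + P.uu x (q + 1 + 1))]
  · rw [G.v_sub hx]
    have e : P.rr x q • P.uu x q - P.rr x (q + 1) • P.uu x (q + 1) -
        (P.rr x q + P.rr x (q + 1)) • -P.uu x (q + 1) =
        P.rr x q • (P.uu x q + P.uu x (q + 1)) := by module
    rw [e, norm_smul, Real.norm_of_nonneg (G.rr_pos hx _).le]
    nlinarith [G.rr_le hx q, norm_nonneg (P.uu x q + P.uu x (q + 1))]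

set_option maxHeartbeats 1600000 in
/-- far vertex near a flat edge point is impossible -/
lemma Good.F5 (G : Good P σ ρ d c) (hx : x ∈ interior P.region) {a p : Fin n} {ε : ℝ}
    (hpa : p ≠ a) (hpa1 : p ≠ a + 1) (hε : ε ≤ ρ * d / 2)
    (h1 : ‖P.uu x a + P.uu x (a + 1)‖ ≤ ε) (h2 : P.rr x p ≤ ρ * d ^ 2 / 8) : False := by
  have hρ := G.hρ
  have hd := G.hd
  have hρ1 := G.hρ1
  have hd1 := G.hd1
  have dp : ρ * d ^ 2 / 8 ≤ d / 2 := by nlinarith [mul_le_mul hρ1 hd1 hd.le zero_le_one]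
  -- distances to the endpoints
  have tri : ∀ j, p ≠ j → d / 2 ≤ P.rr x j := by
    intro j hj
    have h := G.sep p j hj
    rw [G.v_sub hx] at h
    have h' := norm_sub_le (P.rr x p • P.uu x p) (P.rr x j • P.uu x j)
    rw [norm_smul, norm_smul, G.uu_norm hx, G.uu_norm hx, Real.norm_of_nonneg (G.rr_pos hx _).le,
      Real.norm_of_nonneg (G.rr_pos hx _).le] at h'
    linarith
  have ra := tri a hpa
  have ra' := tri (a + 1) hpa1
  have inc := G.inc a
  have sp := G.sep (a + 1) a (fin_ne_succ P.hn a).symm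
  have inc' : ρ * d ≤ XX σ (P.v (a + 1) - P.v a) (c - P.v a) :=
    (mul_le_mul_of_nonneg_left sp hρ.le).trans inc
  have hC1 : ‖c - P.v (a + 1)‖ ≤ 1 := G.bd _ G.cmem _ (P.v_mem _)
  have hC0 : ‖c - P.v a‖ ≤ 1 := G.bd _ G.cmem _ (P.v_mem _)
  have na := G.uu_norm hx a
  have na' := G.uu_norm hx (a + 1)
  have np := G.uu_norm hx p
  have r1 := G.rr_le hx a
  have r1' := G.rr_le hx (a + 1)
  have rp := G.rr_pos hx p
  have E := G.v_sub hx (a + 1) a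
  have E1 := G.v_sub hx p (a + 1)
  have E0 := G.v_sub hx p a
  have inc1 : XX σ (P.v (a + 1) - P.v a) (c - P.v a) =
      XX σ (P.v (a + 1) - P.v a) (c - P.v (a + 1)) := by
    simp only [XX, PiLp.sub_apply]; ring
  have bnd : ∀ {s : ℝ} {u C : E2} {δ : ℝ}, 0 ≤ s → s ≤ 1 → ‖u‖ ≤ δ → ‖C‖ ≤ 1 →
      |s * XX σ u C| ≤ s * δ := by
    intro s u C δ h0 h1 hu hv
    rw [abs_mul, abs_of_nonneg h0]
    have := abs_XX_le G.hσ u C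
    have h2 : ‖u‖ * ‖C‖ ≤ δ := by nlinarith [norm_nonneg u, norm_nonneg C]
    exact mul_le_mul_of_nonneg_left (this.trans h2) h0
  have hε0 : 0 ≤ ε := (norm_nonneg _).trans h1
  have hp1 := G.rr_le hx p
  apply G.ext a p hpa hpa1
  · rw [E1]
    rw [inc1, E] at inc'
    generalize c - P.v (a + 1) = C at *
    generalize P.rr x a = s at *
    generalize P.rr x (a + 1) = s' at *
    generalize P.rr x p = q at *
    generalize P.uu x a = e at *
    generalize P.uu x (a + 1) = e' at *
    generalize P.uu x p = f at *
    have i1 : XX σ (s' • e' - s • e) C = (s + s') * XX σ e' C - s * XX σ (e + e') C := by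
      simp [XX]; ring
    have i2 : XX σ C (q • f - s' • e') = s' * XX σ e' C - q * XX σ f C := by simp [XX]; ring
    rw [i1] at inc'
    rw [i2]
    have b1 := abs_le.1 (bnd (by linarith) r1 h1 hC1)
    have b2 := abs_le.1 (bnd rp.le hp1 np.le hC1)
    have b3 : s * ε ≤ ε := by nlinarith
    have b4 : ρ * d / 2 ≤ (s + s') * XX σ e' C := by linarith
    have b5 : ρ * d / 4 ≤ XX σ e' C := by
      rcases le_total (XX σ e' C) 0 with h0 | h0 <;> nlinarith [mul_pos hρ hd]
    have b6 : d / 2 * (ρ * d / 4) ≤ s' * XX σ e' C := by gcongr; linarith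
    nlinarith
  · rw [E0]
    rw [E] at inc'
    generalize c - P.v a = C at *
    generalize P.rr x a = s at *
    generalize P.rr x (a + 1) = s' at *
    generalize P.rr x p = q at *
    generalize P.uu x a = e at *
    generalize P.uu x (a + 1) = e' at *
    generalize P.uu x p = f at *
    have i1 : XX σ (s' • e' - s • e) C = (s + s') * (- XX σ e C) + s' * XX σ (e + e') C := by
      simp [XX]; ring
    have i2 : XX σ (q • f - s • e) C = s * (- XX σ e C) + q * XX σ f C := by simp [XX]; ring
    rw [i1] at inc'
    rw [i2]
    have b1 := abs_le.1 (bnd (by linarith) r1' h1 hC0)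
    have b2 := abs_le.1 (bnd rp.le hp1 np.le hC0)
    have b3 : s' * ε ≤ ε := by nlinarith
    have b4 : ρ * d / 2 ≤ (s + s') * (- XX σ e C) := by linarith
    have b5 : ρ * d / 4 ≤ - XX σ e C := by
      rcases le_total (- XX σ e C) 0 with h0 | h0 <;> nlinarith [mul_pos hρ hd]
    have b6 : d / 2 * (ρ * d / 4) ≤ s * (- XX σ e C) := by gcongr; linarith
    nlinarith

lemma Good.far_pre (G : Good P σ ρ d c) (hx : x ∈ interior P.region) {a : Fin n} {ε : ℝ}
    (hε : ε ≤ ρ * d / 4) (h1 : ‖P.uu x a + P.uu x (a + 1)‖ ≤ ε) :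
    ρ * d / 4 ≤ XX σ (P.uu x (a + 1)) (c - x) := by
  have inc := G.inc a
  have sp := G.sep (a + 1) a (fin_ne_succ P.hn a).symm
  refine far_gamma G.hσ (G.rr_pos hx a).le (G.rr_pos hx (a + 1)).le (G.rr_le hx _) (G.rr_le hx _)
    (G.uu_norm hx _) h1 (G.bd _ G.cmem _ (interior_subset hx)) (by have := mul_pos G.hρ G.hd; linarith)
    hε ?_
  rw [add_sub_cancel_right, ← G.v_eq hx, ← G.v_eq hx, sub_sub_sub_cancel_right,
    sub_sub_sub_cancel_right]
  calc 4 * (ρ * d / 4) = ρ * d := by ring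
    _ ≤ _ := mul_le_mul_of_nonneg_left sp G.hρ.le
    _ ≤ _ := inc

lemma Good.far_kap (G : Good P σ ρ d c) (hx : x ∈ interior P.region) {a b : Fin n} {ε h e2 : ℝ}
    (hh : 0 < h) (hr : ∀ i, i = a ∨ i = a + 1 ∨ i = b ∨ i = b + 1 → h ≤ P.rr x i)
    (hε : ε ≤ h ^ 2 * e2) (h1 : ‖P.uu x a + P.uu x (a + 1)‖ ≤ ε) :
    -e2 ≤ XX σ (P.uu x (a + 1)) (P.uu x (b + 1)) := by
  refine far_kappa G.hσ (hr a (by simp)) (hr (a + 1) (by simp)) (hr (b + 1) (by simp))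
    (G.rr_le hx _) (G.rr_le hx _) (G.rr_le hx _) hh (G.uu_norm hx _) (G.uu_norm hx _) h1 hε ?_
  rw [add_sub_cancel_right, ← G.v_eq hx, ← G.v_eq hx, ← G.v_eq hx, sub_sub_sub_cancel_right,
    sub_sub_sub_cancel_right]
  exact G.side a _ (P.v_mem _)

lemma Good.far_hf (G : Good P σ ρ d c) (hx : x ∈ interior P.region) {a b : Fin n} {ε h e2 : ℝ}
    (hba : b ≠ a) (hba1 : b ≠ a + 1)
    (hh : 0 < h) (hr : ∀ i, i = a ∨ i = a + 1 ∨ i = b ∨ i = b + 1 → h ≤ P.rr x i)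
    (hε : ε ≤ ρ * d / 4) (hκ : |XX σ (P.uu x (a + 1)) (P.uu x (b + 1))| ≤ e2)
    (hs : 2 * ε + e2 ≤ 2 * h * (ρ * d / 4)) (hε1 : ε ≤ 1)
    (h1 : ‖P.uu x a + P.uu x (a + 1)‖ ≤ ε) (h2 : ‖P.uu x b + P.uu x (b + 1)‖ ≤ ε) :
    P.rr x a * XX σ (P.uu x (a + 1)) (c - x) - P.rr x b * XX σ (P.uu x (b + 1)) (c - x)
      ≤ e2 + 5 * ε := by
  refine far_half G.hσ (hr a (by simp)) (hr (a + 1) (by simp)) (hr b (by simp))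
    (G.rr_le hx _) (G.rr_le hx _) (G.rr_le hx _) hh (G.uu_norm hx _) (G.uu_norm hx _) h1 h2 hε1
    (G.bd _ G.cmem _ (interior_subset hx)) (by have := mul_pos G.hρ G.hd; linarith)
    (G.far_pre hx hε h1) (G.far_pre hx hε h2) hκ hs ?_
  rw [add_sub_cancel_right, add_sub_cancel_right, ← G.v_eq hx, ← G.v_eq hx, ← G.v_eq hx]
  simp only [sub_sub_sub_cancel_right]
  exact G.ext a b hba hba1

lemma Good.F3non (G : Good P σ ρ d c) (hx : x ∈ interior P.region) {a b : Fin n} {ε h e2 : ℝ}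
    (hba : b ≠ a) (hba1 : b ≠ a + 1) (hab1 : a ≠ b + 1)
    (hh : 0 < h) (hr : ∀ i, i = a ∨ i = a + 1 ∨ i = b ∨ i = b + 1 → h ≤ P.rr x i)
    (hε : ε ≤ ρ * d / 4) (hε2 : ε ≤ h ^ 2 * e2)
    (hs : 2 * ε + e2 ≤ 2 * h * (ρ * d / 4)) (hε1 : ε ≤ 1)
    (hs2 : 2 * e2 + 9 * ε < d * (ρ * d / 4))
    (h1 : ‖P.uu x a + P.uu x (a + 1)‖ ≤ ε) (h2 : ‖P.uu x b + P.uu x (b + 1)‖ ≤ ε) : False := by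
  have hr' : ∀ i, i = b ∨ i = b + 1 ∨ i = a ∨ i = a + 1 → h ≤ P.rr x i := by
    intro i hi; apply hr; tauto
  have k1 := G.far_kap hx hh hr hε2 h1
  have k2 := G.far_kap hx hh hr' hε2 h2
  rw [XX_swap] at k2
  have k : |XX σ (P.uu x (a + 1)) (P.uu x (b + 1))| ≤ e2 := abs_le.2 ⟨k1, by linarith⟩
  have k' : |XX σ (P.uu x (b + 1)) (P.uu x (a + 1))| ≤ e2 := by rwa [XX_swap, abs_neg]
  have f1 := G.far_hf hx hba hba1 hh hr hε k hs hε1 h1 h2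
  have f2 := G.far_hf hx hba.symm hab1 hh hr' hε k' hs hε1 h2 h1
  refine far_final G.hσ (G.rr_pos hx a).le (G.rr_pos hx b).le (G.rr_le hx _) (G.rr_le hx _)
    (G.uu_norm hx _) h1 h2 (G.bd _ G.cmem _ (interior_subset hx))
    (by have := mul_pos G.hρ G.hd; linarith) (G.far_pre hx hε h1) k f1 f2 (d := d) ?_ hs2
  rw [add_sub_cancel_right, add_sub_cancel_right, ← G.v_sub hx]
  exact G.sep a b hba.symm

end

end ConvexPolygon

/-- Abstract estimates between half-angle tangents `t` and inverse distances `R`. -/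
structure Abs {n : ℕ} [NeZero n] (M W : ℝ) (t R : Fin n → ℝ) : Prop where
  M1 : 1 ≤ M
  t0 : ∀ a, 0 ≤ t a
  R1 : ∀ p, 1 ≤ R p
  Rb : ∀ p, R p ≤ M * W
  Wa : ∀ a, t a * R a ≤ W
  Wb : ∀ a, t a * R (a + 1) ≤ W
  H2 : ∀ i j, i ≠ j → R i ≤ M ∨ R j ≤ M
  H3 : ∀ a b, a ≠ b → t a ≤ M ∨ t b ≤ M
  H5 : ∀ b p, p ≠ b → p ≠ b + 1 → R p ≤ M ∨ t b ≤ M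

namespace Abs
variable {n : ℕ} [NeZero n] {M W : ℝ} {t R : Fin n → ℝ}

lemma W0 (A : Abs M W t R) : 0 < W := by
  have h1 := A.R1 0
  have h2 := A.Rb 0
  have h3 := A.M1
  by_contra hc
  push Not at hc
  nlinarith

lemma glob (A : Abs M W t R) (b p : Fin n) : t b * R p ≤ M ^ 2 * W := by
  have hM := A.M1
  have hW := A.W0
  have tb := A.t0 b
  have Rp := A.R1 p
  have one : 1 ≤ M ^ 2 := one_le_pow₀ hM
  have hWW : W ≤ M ^ 2 * W := le_mul_of_one_le_left hW.le one
  by_cases h1 : p = b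
  · subst h1; exact (A.Wa p).trans hWW
  by_cases h2 : p = b + 1
  · subst h2; exact (A.Wb b).trans hWW
  rcases A.H5 b p h1 h2 with h | h
  · have h3 : t b ≤ W := by
      have := A.Wa b
      nlinarith [A.R1 b]
    calc t b * R p ≤ W * M := by gcongr
      _ ≤ M ^ 2 * W := by nlinarith [mul_nonneg hW.le (by linarith : (0:ℝ) ≤ M)]
  · calc t b * R p ≤ M * (M * W) := by
          have := A.Rb p
          gcongr
      _ = M ^ 2 * W := by ring

lemma inc (A : Abs M W t R) {a i : Fin n} (h : i = a ∨ i = a + 1) : t a * R i ≤ W := by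
  rcases h with rfl | rfl
  · exact A.Wa _
  · exact A.Wb _

lemma term2 (A : Abs M W t R) {a b i j : Fin n} (hij : i ≠ j) (hi : i = a ∨ i = a + 1)
    (hj : j = b ∨ j = b + 1) : t a * t b * R i ^ 2 * R j ≤ M ^ 7 * W ^ 2 := by
  have hM := A.M1
  have hW := A.W0
  have ta := A.t0 a
  have tb := A.t0 b
  have Ri : 0 ≤ R i := zero_le_one.trans (A.R1 i)
  have Rj : 0 ≤ R j := zero_le_one.trans (A.R1 j)
  have h1 := A.inc hi
  have h2 := A.inc hj
  have M0 : 0 ≤ M := by linarith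
  rcases A.H2 i j hij with h | h
  · calc t a * t b * R i ^ 2 * R j = (t a * R i) * (t b * R j) * R i := by ring
      _ ≤ W * W * M := by gcongr
      _ = M ^ 1 * W ^ 2 := by ring
      _ ≤ M ^ 7 * W ^ 2 := by gcongr; norm_num
  · have h3 := A.glob b i
    calc t a * t b * R i ^ 2 * R j = (t a * R i) * (t b * R i) * R j := by ring
      _ ≤ W * (M ^ 2 * W) * M := by gcongr
      _ = M ^ 3 * W ^ 2 := by ring
      _ ≤ M ^ 7 * W ^ 2 := by gcongr; norm_num

lemma term1 (A : Abs M W t R) {a b i i' j : Fin n} (hij : i ≠ j) (hii : i ≠ i') (hab : a ≠ b)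
    (hi : i = a ∨ i = a + 1) (hi' : i' = a ∨ i' = a + 1)
    (hj : j = b ∨ j = b + 1) :
    (1 + t a ^ 2) * (R i * R i') * t b * R i * R j ≤ 2 * M ^ 7 * W ^ 2 := by
  have hM := A.M1
  have hW := A.W0
  have ta := A.t0 a
  have tb := A.t0 b
  have Ri : 0 ≤ R i := zero_le_one.trans (A.R1 i)
  have Ri' : 0 ≤ R i' := zero_le_one.trans (A.R1 i')
  have Rj : 0 ≤ R j := zero_le_one.trans (A.R1 j)
  have h1 := A.inc hi
  have h1' := A.inc hi'
  have h2 := A.inc hj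
  have g1 := A.glob b i
  have g2 := A.glob a j
  have M0 : 0 ≤ M := by linarith
  have b1 := A.Rb i
  have b2 := A.Rb i'
  by_cases hta : t a ≤ M
  · have q : 1 + t a ^ 2 ≤ 2 * M ^ 2 := by nlinarith
    by_cases hRi : R i ≤ M
    · calc (1 + t a ^ 2) * (R i * R i') * t b * R i * R j
          = (1 + t a ^ 2) * R i ^ 2 * R i' * (t b * R j) := by ring
        _ ≤ (2 * M ^ 2) * M ^ 2 * (M * W) * W := by gcongr
        _ = 2 * M ^ 5 * W ^ 2 := by ring
        _ ≤ 2 * M ^ 7 * W ^ 2 := by gcongr; norm_num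
    · have c1 := (A.H2 i j hij).resolve_left hRi
      have c2 := (A.H2 i i' hii).resolve_left hRi
      calc (1 + t a ^ 2) * (R i * R i') * t b * R i * R j
          = (1 + t a ^ 2) * (t b * R i) * R i * R i' * R j := by ring
        _ ≤ (2 * M ^ 2) * (M ^ 2 * W) * (M * W) * M * M := by gcongr
        _ = 2 * M ^ 7 * W ^ 2 := by ring
  · have htb := (A.H3 a b hab).resolve_left hta
    push Not at hta
    have q : 1 + t a ^ 2 ≤ 2 * t a ^ 2 := by nlinarith
    by_cases hRi : R i ≤ M
    · calc (1 + t a ^ 2) * (R i * R i') * t b * R i * R j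
          ≤ (2 * t a ^ 2) * (R i * R i') * t b * R i * R j := by gcongr
        _ = 2 * (t a * R i') * (t a * R j) * t b * R i ^ 2 := by ring
        _ ≤ 2 * W * (M ^ 2 * W) * M * M ^ 2 := by gcongr
        _ = 2 * M ^ 5 * W ^ 2 := by ring
        _ ≤ 2 * M ^ 7 * W ^ 2 := by gcongr; norm_num
    · have c1 := (A.H2 i j hij).resolve_left hRi
      have c2 := (A.H2 i i' hii).resolve_left hRi
      calc (1 + t a ^ 2) * (R i * R i') * t b * R i * R j
          ≤ (2 * t a ^ 2) * (R i * R i') * t b * R i * R j := by gcongr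
        _ = 2 * (t a * R i) ^ 2 * t b * R i' * R j := by ring
        _ ≤ 2 * W ^ 2 * M * M * M := by gcongr
        _ = 2 * M ^ 3 * W ^ 2 := by ring
        _ ≤ 2 * M ^ 7 * W ^ 2 := by gcongr; norm_num

lemma term1' (A : Abs M W t R) (hn : 3 ≤ n) {a b i j : Fin n} (hij : i ≠ j) (hab : a ≠ b)
    (hi : i = a ∨ i = a + 1) (hj : j = b ∨ j = b + 1) :
    (1 + t a ^ 2) * (R a * R (a + 1)) * t b * R i * R j ≤ 2 * M ^ 7 * W ^ 2 := by
  have hne := ConvexPolygon.fin_ne_succ hn a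
  rcases hi with rfl | rfl
  · exact A.term1 hij hne hab (Or.inl rfl) (Or.inr rfl) hj
  · rw [mul_comm (R a)]
    exact A.term1 hij hne.symm hab (Or.inr rfl) (Or.inl rfl) hj

lemma S_bound (A : Abs M W t R) (hn : 3 ≤ n) {dt dR : Fin n → ℝ} {U : ℝ} (hU : 0 ≤ U)
    (hdt : ∀ a, |dt a| ≤ 3 * (1 + t a ^ 2) * (R a * R (a + 1)) * U)
    (hdR : ∀ i, |dR i| ≤ R i ^ 2 * U)
    {a b i j : Fin n} (hij : i ≠ j) (hi : i = a ∨ i = a + 1) (hj : j = b ∨ j = b + 1) :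
    |(dt a * t b - t a * dt b) * (R i * R j) + t a * t b * (dR i * R j - R i * dR j)|
      ≤ 14 * M ^ 7 * W ^ 2 * U := by
  have hM := A.M1
  have hW := A.W0
  have ta := A.t0 a
  have tb := A.t0 b
  have Ri : 0 ≤ R i := zero_le_one.trans (A.R1 i)
  have Rj : 0 ≤ R j := zero_le_one.trans (A.R1 j)
  have M0 : 0 ≤ M := by linarith
  have k2 : |t a * t b * (dR i * R j - R i * dR j)| ≤ 2 * M ^ 7 * W ^ 2 * U := by
    have e1 := A.term2 hij hi hj
    have e2 := A.term2 hij.symm hj hi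
    have f1 : |dR i * R j| ≤ R i ^ 2 * U * R j := by
      rw [abs_mul, abs_of_nonneg Rj]; exact mul_le_mul_of_nonneg_right (hdR i) Rj
    have f2 : |R i * dR j| ≤ R i * (R j ^ 2 * U) := by
      rw [abs_mul, abs_of_nonneg Ri]; exact mul_le_mul_of_nonneg_left (hdR j) Ri
    rw [abs_mul, abs_of_nonneg (mul_nonneg ta tb)]
    calc t a * t b * |dR i * R j - R i * dR j|
        ≤ t a * t b * (R i ^ 2 * U * R j + R i * (R j ^ 2 * U)) := by
          have := (abs_sub (dR i * R j) (R i * dR j)).trans (add_le_add f1 f2)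
          gcongr
      _ = (t a * t b * R i ^ 2 * R j + t b * t a * R j ^ 2 * R i) * U := by ring
      _ ≤ (M ^ 7 * W ^ 2 + M ^ 7 * W ^ 2) * U := by gcongr
      _ = _ := by ring
  have k1 : |(dt a * t b - t a * dt b) * (R i * R j)| ≤ 12 * M ^ 7 * W ^ 2 * U := by
    by_cases hab : a = b
    · subst hab
      rw [show (dt a * t a - t a * dt a) * (R i * R j) = 0 by ring, abs_zero]
      positivity
    have e1 := A.term1' hn hij hab hi hj
    have e2 := A.term1' hn hij.symm (Ne.symm hab) hj hi
    have f1 : |dt a * t b| ≤ 3 * (1 + t a ^ 2) * (R a * R (a + 1)) * U * t b := by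
      rw [abs_mul, abs_of_nonneg tb]; exact mul_le_mul_of_nonneg_right (hdt a) tb
    have f2 : |t a * dt b| ≤ t a * (3 * (1 + t b ^ 2) * (R b * R (b + 1)) * U) := by
      rw [abs_mul, abs_of_nonneg ta]; exact mul_le_mul_of_nonneg_left (hdt b) ta
    rw [abs_mul, abs_of_nonneg (mul_nonneg Ri Rj)]
    calc |dt a * t b - t a * dt b| * (R i * R j)
        ≤ (3 * (1 + t a ^ 2) * (R a * R (a + 1)) * U * t b
          + t a * (3 * (1 + t b ^ 2) * (R b * R (b + 1)) * U)) * (R i * R j) := by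
          have := (abs_sub (dt a * t b) (t a * dt b)).trans (add_le_add f1 f2)
          gcongr
      _ = 3 * ((1 + t a ^ 2) * (R a * R (a + 1)) * t b * R i * R j
          + (1 + t b ^ 2) * (R b * R (b + 1)) * t a * R j * R i) * U := by ring
      _ ≤ 3 * (2 * M ^ 7 * W ^ 2 + 2 * M ^ 7 * W ^ 2) * U := by gcongr
      _ = _ := by ring
  calc _ ≤ _ := abs_add_le _ _
    _ ≤ 12 * M ^ 7 * W ^ 2 * U + 2 * M ^ 7 * W ^ 2 * U := add_le_add k1 k2
    _ = _ := by ring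

lemma pair_bound (A : Abs M W t R) (hn : 3 ≤ n) {dt dR : Fin n → ℝ} {U : ℝ} (hU : 0 ≤ U)
    (hdt : ∀ a, |dt a| ≤ 3 * (1 + t a ^ 2) * (R a * R (a + 1)) * U)
    (hdR : ∀ i, |dR i| ≤ R i ^ 2 * U) (i j : Fin n) :
    |((dt (i - 1) + dt i) * R i + (t (i - 1) + t i) * dR i) * ((t (j - 1) + t j) * R j)
      - ((t (i - 1) + t i) * R i) * ((dt (j - 1) + dt j) * R j + (t (j - 1) + t j) * dR j)|
      ≤ 56 * M ^ 7 * W ^ 2 * U := by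
  have hM := A.M1
  have M0 : 0 ≤ M := by linarith
  by_cases hij : i = j
  · subst hij
    rw [show ∀ a b : ℝ, a * b - b * a = 0 from fun a b => by ring, abs_zero]
    positivity
  have hi : i = i - 1 ∨ i = i - 1 + 1 := Or.inr (by simp)
  have hj : j = j - 1 ∨ j = j - 1 + 1 := Or.inr (by simp)
  have s1 := A.S_bound hn hU hdt hdR hij hi hj
  have s2 := A.S_bound hn hU hdt hdR hij hi (Or.inl rfl : j = j ∨ j = j + 1)
  have s3 := A.S_bound hn hU hdt hdR hij (Or.inl rfl : i = i ∨ i = i + 1) hj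
  have s4 := A.S_bound hn hU hdt hdR hij (Or.inl rfl : i = i ∨ i = i + 1)
    (Or.inl rfl : j = j ∨ j = j + 1)
  have e : ∀ a b c d : ℝ, |a + b + c + d| ≤ |a| + |b| + |c| + |d| := fun a b c d =>
    (abs_add_le _ _).trans (by gcongr; exact abs_add_three _ _ _)
  refine le_trans (le_trans (le_of_eq ?_) (e _ _ _ _)) (le_trans (add_le_add (add_le_add
    (add_le_add s1 s2) s3) s4) (le_of_eq (by ring)))
  congr 1
  ring

end Abs

def Mc (ρ d : ℝ) : ℝ := 2 / ((ρ * d ^ 2 / 8) ^ 2 * (ρ * d ^ 2 / 8 * (ρ * d ^ 2 / 64)))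

namespace ConvexPolygon
variable {n : ℕ} [NeZero n] {P : ConvexPolygon n} {σ ρ d : ℝ} {c x : E2}

lemma Good.abs (G : Good P σ ρ d c) (hx : x ∈ interior P.region) :
    Abs (Mc ρ d) (∑ j, P.w j x) (fun a => P.t a x) (fun i => (P.rr x i)⁻¹) := by
  have hn := P.hn
  have hρ := G.hρ
  have hd := G.hd
  have hρ1 := G.hρ1
  have hd1 := G.hd1
  obtain ⟨h, hh⟩ : ∃ h, h = ρ * d ^ 2 / 8 := ⟨_, rfl⟩
  obtain ⟨e2, he2⟩ : ∃ e2, e2 = h * (ρ * d ^ 2 / 64) := ⟨_, rfl⟩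
  obtain ⟨ε, hε⟩ : ∃ ε, ε = h ^ 2 * e2 := ⟨_, rfl⟩
  obtain ⟨M, hMdef⟩ : ∃ M, M = Mc ρ d := ⟨_, rfl⟩
  have hM : M = 2 / ε := by rw [hMdef, hε, he2, hh, Mc]
  rw [← hMdef]
  have hdd : d ^ 2 ≤ d := by nlinarith
  have hρd : ρ * d ≤ 1 := mul_le_one₀ hρ1 hd.le hd1
  have hρd0 : 0 < ρ * d := mul_pos hρ hd
  have hρdd : ρ * d ^ 2 ≤ ρ * d := by gcongr
  have hρdd' : ρ * d ^ 2 ≤ d := by nlinarith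
  have hρdd0 : 0 < ρ * d ^ 2 := by positivity
  have h0 : 0 < h := by rw [hh]; positivity
  have e20 : 0 < e2 := by rw [he2]; positivity
  have ε0 : 0 < ε := by rw [hε]; positivity
  have h1 : h ≤ 1 / 8 := by linarith
  have e2h : e2 ≤ h / 64 := by rw [he2]; nlinarith
  have e2m : e2 ≤ ρ * d ^ 2 / 512 := by linarith
  have εe2 : ε ≤ e2 / 64 := by rw [hε]; nlinarith [mul_le_mul h1 h1 h0.le (by norm_num)]
  have M0 : 0 < M := by rw [hM]; positivity
  have hεM : 2 ≤ ε * M := by rw [hM]; field_simp; rfl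
  have inv : ∀ s, 0 < s → ¬ s⁻¹ ≤ M → s < ε := by
    intro s hs hc
    push Not at hc
    have : M * s < 1 := by
      have := mul_lt_mul_of_pos_right hc hs
      rwa [inv_mul_cancel₀ hs.ne'] at this
    nlinarith
  have small : ∀ a, ¬ P.t a x ≤ M → ‖P.uu x a + P.uu x (a + 1)‖ ≤ ε := fun a ha =>
    G.small hx a M0 hεM (lt_of_not_ge ha)
  have Rpos : ∀ i, 0 < (P.rr x i)⁻¹ := fun i => inv_pos.2 (G.rr_pos hx i)
  have tn := P.t_nonneg x
  have weq : ∀ j, P.w j x = (P.t (j - 1) x + P.t j x) * (P.rr x j)⁻¹ := fun j => by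
    rw [w, r_eq, div_eq_mul_inv]
  have w0 : ∀ j, 0 ≤ P.w j x := fun j => by
    rw [weq]; exact mul_nonneg (add_nonneg (tn _) (tn _)) (Rpos j).le
  have wle : ∀ j, P.w j x ≤ ∑ j, P.w j x := fun j =>
    Finset.single_le_sum (f := fun j => P.w j x) (fun i _ => w0 i) (Finset.mem_univ j)
  have Wa : ∀ a, P.t a x * (P.rr x a)⁻¹ ≤ ∑ j, P.w j x := fun a => by
    refine le_trans ?_ (wle a)
    rw [weq]
    exact mul_le_mul_of_nonneg_right (by linarith [tn (a - 1)]) (Rpos a).le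
  have Wb : ∀ a, P.t a x * (P.rr x (a + 1))⁻¹ ≤ ∑ j, P.w j x := fun a => by
    refine le_trans ?_ (wle (a + 1))
    rw [weq, add_sub_cancel_right]
    exact mul_le_mul_of_nonneg_right (by linarith [tn (a + 1)]) (Rpos _).le
  refine ⟨?_, tn, fun p => ?_, fun p => ?_, Wa, Wb, fun i j hij => ?_, fun a b hab => ?_,
    fun b p hb hb1 => ?_⟩
  · nlinarith
  · exact (one_le_inv₀ (G.rr_pos hx p)).2 (G.rr_le hx p)
  · obtain ⟨q, -, hq⟩ := Finset.exists_min_image Finset.univ (fun i => P.rr x i)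
      ⟨p, Finset.mem_univ p⟩
    have hq' : ∀ i, P.rr x (q - 1 + 1) ≤ P.rr x i := fun i => by
      rw [sub_add_cancel]; exact hq i (Finset.mem_univ i)
    have key : ρ * d / 2 * (P.rr x (q - 1 + 1))⁻¹ ≤ ∑ j, P.w j x := by
      rcases G.F2 hx (q - 1) (hq' _) (hq' _) with hc | hc
      · exact (mul_le_mul_of_nonneg_right hc (Rpos _).le).trans (Wb _)
      · exact (mul_le_mul_of_nonneg_right hc (Rpos _).le).trans (Wa _)
    have k2 : (P.rr x p)⁻¹ ≤ (P.rr x (q - 1 + 1))⁻¹ := inv_anti₀ (G.rr_pos hx _) (hq' p)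
    have k3 : 1 ≤ M * (ρ * d / 2) := by nlinarith
    calc (P.rr x p)⁻¹ ≤ (P.rr x (q - 1 + 1))⁻¹ := k2
      _ ≤ M * (ρ * d / 2) * (P.rr x (q - 1 + 1))⁻¹ := le_mul_of_one_le_left (Rpos _).le k3
      _ = M * (ρ * d / 2 * (P.rr x (q - 1 + 1))⁻¹) := by ring
      _ ≤ _ := by gcongr
  · by_contra hc
    rw [not_or] at hc
    have k1 := inv _ (G.rr_pos hx i) hc.1
    have k2 := inv _ (G.rr_pos hx j) hc.2
    have hs := G.sep i j hij
    have := norm_sub_le (P.v i - x) (P.v j - x)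
    rw [sub_sub_sub_cancel_right] at this
    rw [rr] at k1 k2
    linarith
  · by_contra hc
    rw [not_or] at hc
    have s1 := small a hc.1
    have s2 := small b hc.2
    by_cases hb1 : b = a + 1
    · subst hb1
      exact G.F3adj hx a (by linarith) s1 s2
    by_cases ha1 : a = b + 1
    · subst ha1
      exact G.F3adj hx b (by linarith) s2 s1
    have hne : a + 1 ≠ b + 1 := fun h => hab (add_right_cancel h)
    refine G.F3non hx (Ne.symm hab) hb1 ha1 h0 ?_ (by linarith) hε.le ?_ (by linarith) ?_ s1 s2
    · intro i hi
      by_contra hlt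
      push Not at hlt
      rw [hh] at hlt
      rcases hi with rfl | rfl | rfl | rfl
      · exact G.F5 hx hab ha1 (by linarith) s2 hlt.le
      · exact G.F5 hx (Ne.symm hb1) hne (by linarith) s2 hlt.le
      · exact G.F5 hx (Ne.symm hab) hb1 (by linarith) s1 hlt.le
      · exact G.F5 hx (Ne.symm ha1) hne.symm (by linarith) s1 hlt.le
    · have : e2 ≤ h * (ρ * d / 64) := by rw [he2]; gcongr
      nlinarith
    · nlinarith
  · by_contra hc
    rw [not_or] at hc
    have k1 := inv _ (G.rr_pos hx p) hc.1
    exact G.F5 hx hb hb1 (by linarith) (small b hc.2) (by rw [← hh]; linarith)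

end ConvexPolygon

lemma hasFDerivAt_inv_norm {p x : E2} (h : p - x ≠ 0) :
    ∃ L : E2 →L[ℝ] ℝ, HasFDerivAt (fun y => ‖p - y‖⁻¹) L x ∧
      ∀ u, |L u| ≤ (‖p - x‖⁻¹) ^ 2 * ‖u‖ := by
  have h0 : 0 < ‖p - x‖ := norm_pos_iff.2 h
  have hd : DifferentiableAt ℝ (fun y : E2 => ‖p - y‖) x :=
    DifferentiableAt.norm ℝ (by fun_prop) h
  have h1 : LipschitzWith 1 (fun y : E2 => ‖p - y‖) := by
    refine LipschitzWith.of_dist_le_mul fun y z => ?_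
    rw [Real.dist_eq, NNReal.coe_one, one_mul, dist_eq_norm]
    refine (abs_norm_sub_norm_le _ _).trans (le_of_eq ?_)
    rw [sub_sub_sub_cancel_left, norm_sub_rev]
  have h2 : ‖fderiv ℝ (fun y : E2 => ‖p - y‖) x‖ ≤ 1 := by
    simpa using norm_fderiv_le_of_lipschitz ℝ h1 (x₀ := x)
  refine ⟨_, (hasDerivAt_inv h0.ne').comp_hasFDerivAt x hd.hasFDerivAt, fun u => ?_⟩
  have h3 := (fderiv ℝ (fun y : E2 => ‖p - y‖) x).le_of_opNorm_le h2 u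
  rw [Real.norm_eq_abs, one_mul] at h3
  simp only [ContinuousLinearMap.smul_apply, smul_eq_mul, abs_mul, abs_neg]
  rw [abs_of_nonneg (by positivity), inv_pow]
  gcongr

namespace ConvexPolygon
variable {n : ℕ} [NeZero n] {P : ConvexPolygon n} {σ ρ d : ℝ} {c x : E2}

lemma Good.grad_le (G : Good P σ ρ d c) (hx : x ∈ interior P.region) (i : Fin n) :
    ‖gradient (P.lambda i) x‖ ≤ n * (56 * Mc ρ d ^ 7) := by
  have hn := P.hn
  have A := G.abs hx
  have hW := A.W0
  have ht : ∀ a, ∃ L : E2 →L[ℝ] ℝ, HasFDerivAt (fun y => P.t a y) L x ∧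
      ∀ u, |L u| ≤ 3 * (1 + P.t a x ^ 2) * ((P.rr x a)⁻¹ * (P.rr x (a + 1))⁻¹) * ‖u‖ := by
    intro a
    exact differentiable_tan G.hσ (G.pos hx a) (G.rr_le hx a) (G.rr_le hx (a + 1))
      (G.bd _ (P.v_mem _) _ (P.v_mem _))
  have hr : ∀ a, ∃ L : E2 →L[ℝ] ℝ, HasFDerivAt (fun y => (P.rr y a)⁻¹) L x ∧
      ∀ u, |L u| ≤ ((P.rr x a)⁻¹) ^ 2 * ‖u‖ := fun a => hasFDerivAt_inv_norm (G.ne hx a)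
  choose dt hdt hdtb using ht
  choose dR hdR hdRb using hr
  have weq : ∀ j, P.w j = fun y => (P.t (j - 1) y + P.t j y) * (P.rr y j)⁻¹ := fun j => by
    funext y
    rw [w, r_eq, div_eq_mul_inv]
  have hw : ∀ j, HasFDerivAt (P.w j) ((P.t (j - 1) x + P.t j x) • dR j +
      (P.rr x j)⁻¹ • (dt (j - 1) + dt j)) x := by
    intro j
    rw [weq j]
    exact ((hdt (j - 1)).add (hdt j)).mul (hdR j)
  have hS : HasFDerivAt (fun y => ∑ j, P.w j y) (∑ j, ((P.t (j - 1) x + P.t j x) • dR j +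
      (P.rr x j)⁻¹ • (dt (j - 1) + dt j))) x := HasFDerivAt.fun_sum fun j _ => hw j
  have hl := (hw i).fun_mul ((hasDerivAt_inv hW.ne').comp_hasFDerivAt x hS)
  have hlam : P.lambda i = fun y => P.w i y * ((fun z : ℝ => z⁻¹) ∘ fun y => ∑ j, P.w j y) y := by
    funext y; rw [lambda, div_eq_mul_inv]; rfl
  rw [← hlam] at hl
  have hnorm : ‖gradient (P.lambda i) x‖ = ‖fderiv ℝ (P.lambda i) x‖ := by
    rw [gradient, LinearIsometryEquiv.norm_map]
  rw [hnorm, hl.fderiv]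
  have hM := A.M1
  refine ContinuousLinearMap.opNorm_le_bound _ (by positivity) fun u => ?_
  have pb := fun j => A.pair_bound hn (norm_nonneg u) (fun a => hdtb a u) (fun a => hdRb a u) i j
  rw [Real.norm_eq_abs]
  set W := ∑ j, P.w j x with hWdef
  have e : ((P.w i x • ((-(W ^ 2)⁻¹) • ∑ j, ((P.t (j - 1) x + P.t j x) • dR j
        + (P.rr x j)⁻¹ • (dt (j - 1) + dt j)))
      + W⁻¹ • ((P.t (i - 1) x + P.t i x) • dR i + (P.rr x i)⁻¹ • (dt (i - 1) + dt i)))) u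
      = (1 / W ^ 2) * ∑ j, (((dt (i - 1) u + dt i u) * (P.rr x i)⁻¹ + (P.t (i - 1) x + P.t i x) * dR i u)
        * ((P.t (j - 1) x + P.t j x) * (P.rr x j)⁻¹)
      - ((P.t (i - 1) x + P.t i x) * (P.rr x i)⁻¹) * ((dt (j - 1) u + dt j u) * (P.rr x j)⁻¹
        + (P.t (j - 1) x + P.t j x) * dR j u)) := by
    have hWe : W = ∑ j, (P.t (j - 1) x + P.t j x) * (P.rr x j)⁻¹ := by
      rw [hWdef]; exact Finset.sum_congr rfl fun j _ => by rw [weq j]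
    rw [Finset.sum_sub_distrib, ← Finset.mul_sum, ← Finset.mul_sum, ← hWe]
    simp only [ContinuousLinearMap.smul_apply, ContinuousLinearMap.sub_apply,
      ContinuousLinearMap.add_apply, ContinuousLinearMap.sum_apply, smul_eq_mul]
    rw [weq i]
    rw [show ∑ j, ((dt (j - 1) u + dt j u) * (P.rr x j)⁻¹ + (P.t (j - 1) x + P.t j x) * dR j u)
      = ∑ j, ((P.t (j - 1) x + P.t j x) * dR j u + (P.rr x j)⁻¹ * (dt (j - 1) u + dt j u)) from
      Finset.sum_congr rfl fun j _ => by ring]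
    field_simp
    ring
  rw [show ((fun y : ℝ => y⁻¹) ∘ fun y => ∑ j, P.w j y) x = W⁻¹ from rfl, e]
  rw [abs_mul, abs_of_nonneg (by positivity)]
  calc _ ≤ 1 / W ^ 2 * ∑ j : Fin n, 56 * Mc ρ d ^ 7 * W ^ 2 * ‖u‖ := by
        gcongr
        exact (Finset.abs_sum_le_sum_abs _ _).trans (Finset.sum_le_sum fun j _ => pb j)
    _ = _ := by
        rw [Finset.sum_const, Finset.card_univ, Fintype.card_fin, nsmul_eq_mul]
        field_simp

lemma Good.lambda_sq (G : Good P σ ρ d c) (hx : x ∈ interior P.region) (i : Fin n) :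
    P.lambda i x ^ 2 ≤ 1 := by
  have A := G.abs hx
  have hW := A.W0
  have w0 : ∀ j, 0 ≤ P.w j x := fun j => by
    rw [w, r_eq]
    exact div_nonneg (add_nonneg (P.t_nonneg _ _) (P.t_nonneg _ _)) (G.rr_pos hx j).le
  have wle : P.w i x ≤ ∑ j, P.w j x :=
    Finset.single_le_sum (f := fun j => P.w j x) (fun i _ => w0 i) (Finset.mem_univ i)
  have h1 : P.lambda i x ≤ 1 := by rw [lambda, div_le_one hW]; exact wle
  have h0 : 0 ≤ P.lambda i x := div_nonneg (w0 i) hW.le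
  exact pow_le_one₀ h0 h1

lemma card_bound (d : ℝ) (hd : 0 < d) : ∃ N : ℕ, ∀ (n : ℕ) (v : Fin n → E2),
    (∀ i j, ‖v i - v j‖ ≤ 1) → (∀ i j, i ≠ j → d ≤ ‖v i - v j‖) → n ≤ N := by
  obtain ⟨s, hs, hfin, hcov⟩ := Metric.finite_approx_of_totallyBounded
    (isCompact_closedBall (0 : E2) 1).totallyBounded (d / 2) (by positivity)
  refine ⟨hfin.toFinset.card, fun n v h1 h2 => ?_⟩
  rcases Nat.eq_zero_or_pos n with h0 | h0
  · omega
  have hc : ∀ i, ∃ y ∈ s, dist (v i - v ⟨0, h0⟩) y < d / 2 := by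
    intro i
    have := hcov (show v i - v ⟨0, h0⟩ ∈ closedBall (0 : E2) 1 by
      rw [mem_closedBall_zero_iff]; exact h1 _ _)
    simpa using this
  choose f hf hfd using hc
  have hinj : Function.Injective f := by
    intro i j hij
    by_contra hne
    have h3 := h2 i j hne
    have h4 := dist_triangle_right (v i - v ⟨0, h0⟩) (v j - v ⟨0, h0⟩) (f i)
    have h5 := hfd i
    have h6 := hfd j
    rw [← hij] at h6
    rw [dist_eq_norm (v i - _) (v j - _), sub_sub_sub_cancel_right] at h4
    linarith
  have := Finset.card_le_card_of_injOn (s := Finset.univ) (t := hfin.toFinset) f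
    (fun i _ => by simpa using hf i) hinj.injOn
  simpa using this

lemma Good.integral_le (G : Good P σ ρ d c) (i : Fin n) :
    ∫ x in P.region, ((P.lambda i x) ^ 2 + ‖gradient (P.lambda i) x‖ ^ 2)
      ≤ (1 + (n * (56 * Mc ρ d ^ 7)) ^ 2) *
        (MeasureTheory.volume : MeasureTheory.Measure E2).real (closedBall 0 1) := by
  set K := 1 + ((n : ℝ) * (56 * Mc ρ d ^ 7)) ^ 2 with hK
  have hK0 : 0 ≤ K := by positivity
  have hfr : (MeasureTheory.volume : MeasureTheory.Measure E2) (frontier P.region) = 0 :=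
    P.region_convex.addHaar_frontier _
  have hae : ∀ᵐ x ∂(MeasureTheory.volume : MeasureTheory.Measure E2), x ∈ P.region →
      ‖(P.lambda i x) ^ 2 + ‖gradient (P.lambda i) x‖ ^ 2‖ ≤ K := by
    have h0 : ∀ᵐ x ∂(MeasureTheory.volume : MeasureTheory.Measure E2), x ∉ frontier P.region :=
      MeasureTheory.measure_eq_zero_iff_ae_notMem.1 hfr
    filter_upwards [h0] with x hxf hx
    have hxi : x ∈ interior P.region := by
      by_contra hc
      exact hxf ⟨subset_closure hx, hc⟩
    rw [Real.norm_of_nonneg (by positivity), hK]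
    have := G.grad_le hxi i
    have := G.lambda_sq hxi i
    gcongr
  have hfin : (MeasureTheory.volume : MeasureTheory.Measure E2) P.region < ⊤ :=
    P.region_compact.measure_lt_top
  have h1 := MeasureTheory.norm_setIntegral_le_of_norm_le_const_ae' hfin hae
  have h2 : (MeasureTheory.volume : MeasureTheory.Measure E2).real P.region ≤
      (MeasureTheory.volume : MeasureTheory.Measure E2).real (closedBall 0 1) := by
    have hsub : P.region ⊆ closedBall c 1 := fun y hy => by
      rw [mem_closedBall, dist_eq_norm]; exact G.bd _ hy _ G.cmem
    have h3 := MeasureTheory.measureReal_mono (μ := (MeasureTheory.volume : MeasureTheory.Measure E2))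
      hsub (isCompact_closedBall c 1).measure_lt_top.ne
    refine h3.trans (le_of_eq ?_)
    rw [MeasureTheory.measureReal_def, MeasureTheory.measureReal_def,
      MeasureTheory.Measure.addHaar_closedBall_center]
  exact (Real.le_norm_self _).trans (h1.trans (mul_le_mul_of_nonneg_left h2 hK0))

end ConvexPolygon

open ConvexPolygon in
/-- under G1 and G2 there is a uniform constant `C_λ` such that each mean
value coordinate satisfies the H¹-norm bound `∫_Ω (λ_i² + ‖∇λ_i‖²) ≤ C_λ²`. -/
theorem mean_value_H1_bound (γstar dstar : ℝ) (hγ : 0 < γstar) (hd : 0 < dstar) :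
    ∃ Clam : ℝ, 0 < Clam ∧
      ∀ (n : ℕ) [NeZero n] (P : ConvexPolygon n),
        Metric.diam P.region = 1 → P.G1 γstar → P.G2 dstar →
        ∀ i : Fin n,
          ∫ x in P.region, ((P.lambda i x) ^ 2 + ‖gradient (P.lambda i) x‖ ^ 2)
            ≤ Clam ^ 2 := by
  obtain ⟨N, hN⟩ := card_bound (min 1 dstar) (lt_min one_pos hd)
  set V := (MeasureTheory.volume : MeasureTheory.Measure E2).real (closedBall 0 1)
  have hV : 0 ≤ V := MeasureTheory.measureReal_nonneg
  set M := Mc (min 1 (1 / γstar)) (min 1 dstar)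
  set B := (1 + ((N : ℝ) * (56 * M ^ 7)) ^ 2) * V with hB
  have hB0 : 0 ≤ B := by positivity
  refine ⟨1 + B, by positivity, ?_⟩
  intro n _ P hdiam h1 h2 i
  obtain ⟨σ, c, G⟩ := P.exists_good hγ hd hdiam h1 h2
  have hn : n ≤ N := hN n P.v (fun i j => G.bd _ (P.v_mem i) _ (P.v_mem j)) G.sep
  have hn' : (n : ℝ) ≤ N := by exact_mod_cast hn
  have hM0 : 0 < M := by
    have := G.hρ
    have := G.hd
    show 0 < Mc _ _
    unfold Mc
    positivity
  refine (G.integral_le i).trans ?_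
  have : (1 + ((n : ℝ) * (56 * M ^ 7)) ^ 2) * V ≤ B := by
    rw [hB]; gcongr
  refine this.trans ?_
  nlinarith
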